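/- arXiv:1703.07173 — 3 statements merged into one kernel-verified Lean document; each statement's English description precedes it below -/
import Mathlib

section
/- Let f ∈ ℂ[x,y,z] be homogeneous of degree d ≥ 2 with f_x, f_y, f_z a regular sequence, and R the Jacobian ring. For 0 ≤ k ≤ N = 3(d-2), the multiplication pairing R^k × R^{N-k} → R^N ≅ ℂ is a perfect pairing; in particular dim R^k = dim R^{N-k}. -/
open MvPolynomial Module

namespace JacPair

/-- Elementwise form of being a weakly regular sequence of length three. -/
structure Reg3 {S : Type*} [CommRing S] (g1 g2 g3 : S) : Prop where
  r1 : ∀ p, p * g1 = 0 → p = 0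
  r2 : ∀ p q, p * g2 = q * g1 → ∃ r, p = r * g1
  r3 : ∀ p q r, p * g3 = q * g1 + r * g2 → ∃ s t, p = s * g1 + t * g2

/-- Exactness of the Koszul complex at the middle spot. -/
lemma Reg3.koszul1 {S : Type*} [CommRing S] {g1 g2 g3 : S} (h : Reg3 g1 g2 g3) {a1 a2 a3 : S}
    (ha : a1 * g1 + a2 * g2 + a3 * g3 = 0) :
    ∃ c1 c2 c3, a1 = c2 * g3 - c3 * g2 ∧ a2 = c3 * g1 - c1 * g3 ∧ a3 = c1 * g2 - c2 * g1 := by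
  obtain ⟨p, q, hpq⟩ := h.r3 a3 (-a1) (-a2) (by linear_combination ha)
  obtain ⟨r, hr⟩ := h.r2 (a2 + q * g3) (-(a1 + p * g3))
    (by linear_combination ha - g3 * hpq)
  have h1 : a1 + p * g3 + r * g2 = 0 := by
    apply h.r1
    linear_combination ha - g3 * hpq - g2 * hr
  exact ⟨q, -p, r, by linear_combination h1, by linear_combination hr,
    by linear_combination hpq⟩

/-- Exactness of the Koszul complex at the second spot. -/
lemma Reg3.koszul2 {S : Type*} [CommRing S] {g1 g2 g3 : S} (h : Reg3 g1 g2 g3) {c1 c2 c3 : S}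
    (h2 : c3 * g1 = c1 * g3) (h3 : c1 * g2 = c2 * g1) :
    ∃ b, c1 = b * g1 ∧ c2 = b * g2 ∧ c3 = b * g3 := by
  obtain ⟨b, hb⟩ := h.r2 c1 c2 h3
  refine ⟨b, hb, ?_, ?_⟩
  · rw [← sub_eq_zero]
    apply h.r1
    linear_combination g2 * hb - h3
  · rw [← sub_eq_zero]
    apply h.r1
    linear_combination h2 + g3 * hb

/-- The ring `ℂ[x,y,z]`. -/
abbrev S := MvPolynomial (Fin 3) ℂ

/-- Component of degree `n - e`, zero when `n < e`. -/
noncomputable def pr (e n : ℕ) (p : S) : S :=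
  if e ≤ n then homogeneousComponent (n - e) p else 0

lemma pr_hom (e n : ℕ) (p : S) : (pr e n p).IsHomogeneous (n - e) := by
  unfold pr
  split_ifs
  · exact homogeneousComponent_isHomogeneous _ _
  · exact isHomogeneous_zero _ _ _

attribute [local instance] MvPolynomial.gradedAlgebra in
lemma hc_mul (e n : ℕ) (p g : S) (hg : g.IsHomogeneous e) :
    homogeneousComponent n (p * g) = pr e n p * g := by
  have := DirectSum.coe_decompose_mul_of_right_mem (homogeneousSubmodule (Fin 3) ℂ) n
    (a := p) (b := g) (i := e) hg
  have key (q : S) (m : ℕ) :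
      ((DirectSum.decompose (homogeneousSubmodule (Fin 3) ℂ) q m : _) : S) =
        homogeneousComponent m q := decomposition.decompose'_apply q m
  rw [key, key] at this
  unfold pr
  rw [ite_mul, zero_mul]
  exact this

/-- Components of an identity with homogeneous left side. -/
lemma comp3 {e n : ℕ} {g1 g2 g3 : S} (h1 : g1.IsHomogeneous e) (h2 : g2.IsHomogeneous e)
    (h3 : g3.IsHomogeneous e) {u a1 a2 a3 : S} (hu : u.IsHomogeneous n)
    (h : u = a1 * g1 + a2 * g2 + a3 * g3) :
    u = pr e n a1 * g1 + pr e n a2 * g2 + pr e n a3 * g3 := by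
  have := congrArg (homogeneousComponent n) h
  rwa [map_add, map_add, hc_mul e n _ _ h1, hc_mul e n _ _ h2, hc_mul e n _ _ h3,
    homogeneousComponent_eq_self hu] at this

lemma comp2 {e n : ℕ} {g1 g2 : S} (h1 : g1.IsHomogeneous e) (h2 : g2.IsHomogeneous e)
    {u a1 a2 : S} (hu : u.IsHomogeneous n)
    (h : u = a1 * g1 - a2 * g2) :
    u = pr e n a1 * g1 - pr e n a2 * g2 := by
  have := congrArg (homogeneousComponent n) h
  rwa [map_sub, hc_mul e n _ _ h1, hc_mul e n _ _ h2,
    homogeneousComponent_eq_self hu] at this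

lemma low_zero {e n : ℕ} {g : S} (h1 : g.IsHomogeneous e)
    {u b : S} (hu : u.IsHomogeneous n) (h : u = b * g) (hn : n < e) : u = 0 := by
  have := congrArg (homogeneousComponent n) h
  rw [hc_mul e n _ _ h1, homogeneousComponent_eq_self hu] at this
  rw [this, pr, if_neg (by omega), zero_mul]

/-- Graded form of `Reg3.koszul1`. -/
lemma koszul1_graded {e n : ℕ} {g1 g2 g3 : S} (h : Reg3 g1 g2 g3)
    (h1 : g1.IsHomogeneous e) (h2 : g2.IsHomogeneous e)
    (h3 : g3.IsHomogeneous e) {a1 a2 a3 : S} (i1 : a1.IsHomogeneous n)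
    (i2 : a2.IsHomogeneous n) (i3 : a3.IsHomogeneous n)
    (ha : a1 * g1 + a2 * g2 + a3 * g3 = 0) :
    ∃ c1 c2 c3 : S, c1.IsHomogeneous (n - e) ∧ c2.IsHomogeneous (n - e) ∧
      c3.IsHomogeneous (n - e) ∧
      a1 = c2 * g3 - c3 * g2 ∧ a2 = c3 * g1 - c1 * g3 ∧ a3 = c1 * g2 - c2 * g1 := by
  obtain ⟨c1, c2, c3, e1, e2, e3⟩ := h.koszul1 ha
  exact ⟨pr e n c1, pr e n c2, pr e n c3, pr_hom _ _ _, pr_hom _ _ _, pr_hom _ _ _,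
    comp2 h3 h2 i1 e1, comp2 h1 h3 i2 e2, comp2 h2 h1 i3 e3⟩

lemma mem3 {R : Type*} [CommRing R] {g1 g2 g3 u : R} :
    u ∈ Ideal.span {g1, g2, g3} ↔ ∃ a1 a2 a3, u = a1 * g1 + a2 * g2 + a3 * g3 := by
  rw [Ideal.mem_span_insert]
  constructor
  · rintro ⟨a, z, hz, rfl⟩
    obtain ⟨b, c, rfl⟩ := Ideal.mem_span_pair.1 hz
    exact ⟨a, b, c, by ring⟩
  · rintro ⟨a, b, c, rfl⟩
    exact ⟨a, b * g2 + c * g3, Ideal.mem_span_pair.2 ⟨b, c, rfl⟩, by ring⟩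

lemma regX : Reg3 (X 0 : S) (X 1) (X 2) where
  r1 p hp := by
    rcases mul_eq_zero.1 hp with h | h
    · exact h
    · exact absurd h (X_ne_zero _)
  r2 p q h := by
    have hd : (X 0 : S) ∣ p * X 1 := ⟨q, by rw [h, mul_comm]⟩
    rcases (X_prime (R := ℂ) (i := (0 : Fin 3))).dvd_or_dvd hd with ⟨r, hr⟩ | h'
    · exact ⟨r, by rw [hr, mul_comm]⟩
    · rw [X_dvd_X] at h'
      simp at h'
  r3 p q r h := by
    have key : p ∈ Ideal.span ((X : Fin 3 → S) '' {0, 1}) := by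
      have hm : p * X 2 ∈ Ideal.span ((X : Fin 3 → S) '' {0, 1}) := by
        rw [Set.image_pair, Ideal.mem_span_pair]
        exact ⟨q, r, h.symm⟩
      rw [mem_ideal_span_X_image] at hm ⊢
      intro m hm'
      obtain ⟨i, hi, hi2⟩ := hm (m + Finsupp.single 2 1) (by
        rw [MvPolynomial.mem_support_iff, coeff_mul_X]; exact MvPolynomial.mem_support_iff.1 hm')
      refine ⟨i, hi, ?_⟩
      rcases hi with rfl | rfl <;> simpa using hi2
    rw [Set.image_pair, Ideal.mem_span_pair] at key
    obtain ⟨a, b, hab⟩ := key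
    exact ⟨a, b, hab.symm⟩

/-- The socle of the quotient vanishes in degrees below `3e-3`. -/
lemma socle {e k : ℕ} {g1 g2 g3 : S} (h : Reg3 g1 g2 g3)
    (h1 : g1.IsHomogeneous e) (h2 : g2.IsHomogeneous e) (h3 : g3.IsHomogeneous e)
    (hk : k + 3 < 3 * e) {u : S} (hu : u.IsHomogeneous k)
    (hX : ∀ i : Fin 3, u * X i ∈ Ideal.span {g1, g2, g3}) :
    u ∈ Ideal.span {g1, g2, g3} := by
  have step (i : Fin 3) : ∃ a1 a2 a3 : S, a1.IsHomogeneous (k + 1 - e) ∧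
      a2.IsHomogeneous (k + 1 - e) ∧ a3.IsHomogeneous (k + 1 - e) ∧
      u * X i = a1 * g1 + a2 * g2 + a3 * g3 := by
    obtain ⟨a1, a2, a3, ha⟩ := mem3.1 (hX i)
    exact ⟨_, _, _, pr_hom _ _ _, pr_hom _ _ _, pr_hom _ _ _,
      comp3 h1 h2 h3 (hu.mul (isHomogeneous_X ℂ i)) ha⟩
  obtain ⟨a11, a12, a13, d11, d12, d13, e1⟩ := step 0
  obtain ⟨a21, a22, a23, d21, d22, d23, e2⟩ := step 1
  obtain ⟨a31, a32, a33, d31, d32, d33, e3⟩ := step 2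
  set x : S := X 0 with hx
  set y : S := X 1 with hy
  set z : S := X 2 with hz
  have dx : x.IsHomogeneous 1 := isHomogeneous_X ℂ 0
  have dy : y.IsHomogeneous 1 := isHomogeneous_X ℂ 1
  have dz : z.IsHomogeneous 1 := isHomogeneous_X ℂ 2
  obtain ⟨c11, c12, c13, f11, f12, f13, m11, m12, m13⟩ := koszul1_graded h h1 h2 h3
    ((d31.mul dy).sub (d21.mul dz)) ((d32.mul dy).sub (d22.mul dz))
    ((d33.mul dy).sub (d23.mul dz)) (by linear_combination z * e2 - y * e3)
  obtain ⟨c21, c22, c23, f21, f22, f23, m21, m22, m23⟩ := koszul1_graded h h1 h2 h3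
    ((d11.mul dz).sub (d31.mul dx)) ((d12.mul dz).sub (d32.mul dx))
    ((d13.mul dz).sub (d33.mul dx)) (by linear_combination x * e3 - z * e1)
  obtain ⟨c31, c32, c33, f31, f32, f33, m31, m32, m33⟩ := koszul1_graded h h1 h2 h3
    ((d21.mul dx).sub (d11.mul dy)) ((d22.mul dx).sub (d12.mul dy))
    ((d23.mul dx).sub (d13.mul dy)) (by linear_combination y * e1 - x * e2)
  obtain ⟨b, b1, b2, b3⟩ := h.koszul2
    (c1 := c11 * x + c21 * y + c31 * z) (c2 := c12 * x + c22 * y + c32 * z)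
    (c3 := c13 * x + c23 * y + c33 * z)
    (by linear_combination (-x) * m12 - y * m22 - z * m32)
    (by linear_combination (-x) * m13 - y * m23 - z * m33)
  have hlt : k + 1 - e + 1 - e + 1 < e := by omega
  have z1 := low_zero h1 (((f11.mul dx).add (f21.mul dy)).add (f31.mul dz)) b1 hlt
  have z2 := low_zero h2 (((f12.mul dx).add (f22.mul dy)).add (f32.mul dz)) b2 hlt
  have z3 := low_zero h3 (((f13.mul dx).add (f23.mul dy)).add (f33.mul dz)) b3 hlt
  obtain ⟨w11, w21, w31, n11, n21, n31⟩ := regX.koszul1 z1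
  obtain ⟨w12, w22, w32, n12, n22, n32⟩ := regX.koszul1 z2
  obtain ⟨w13, w23, w33, n13, n23, n33⟩ := regX.koszul1 z3
  simp only [← hx, ← hy, ← hz] at n11 n21 n31 n12 n22 n32 n13 n23 n33
  subst n11 n21 n31 n12 n22 n32 n13 n23 n33
  -- the corrected vectors
  obtain ⟨v1, p11, p21, p31⟩ := regX.koszul2
    (c1 := a11 + (w12 * g3 - w13 * g2)) (c2 := a21 + (w22 * g3 - w23 * g2))
    (c3 := a31 + (w32 * g3 - w33 * g2))
    (by rw [← hx, ← hz]; linear_combination -m21)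
    (by rw [← hx, ← hy]; linear_combination -m31)
  obtain ⟨v2, p12, p22, p32⟩ := regX.koszul2
    (c1 := a12 + (w13 * g1 - w11 * g3)) (c2 := a22 + (w23 * g1 - w21 * g3))
    (c3 := a32 + (w33 * g1 - w31 * g3))
    (by rw [← hx, ← hz]; linear_combination -m22)
    (by rw [← hx, ← hy]; linear_combination -m32)
  obtain ⟨v3, p13, p23, p33⟩ := regX.koszul2
    (c1 := a13 + (w11 * g2 - w12 * g1)) (c2 := a23 + (w21 * g2 - w22 * g1))
    (c3 := a33 + (w31 * g2 - w32 * g1))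
    (by rw [← hx, ← hz]; linear_combination -m23)
    (by rw [← hx, ← hy]; linear_combination -m33)
  refine mem3.2 ⟨v1, v2, v3, ?_⟩
  rw [← sub_eq_zero]
  apply regX.r1
  rw [← hx] at p11 p12 p13 ⊢
  linear_combination e1 + g1 * p11 + g2 * p12 + g3 * p13

lemma nondeg {e : ℕ} {g1 g2 g3 : S} (h : Reg3 g1 g2 g3)
    (h1 : g1.IsHomogeneous e) (h2 : g2.IsHomogeneous e) (h3 : g3.IsHomogeneous e) (j : ℕ) :
    ∀ k, k + j + 3 = 3 * e → ∀ u : S, u.IsHomogeneous k → u ∉ Ideal.span {g1, g2, g3} →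
      ∃ v : S, v.IsHomogeneous j ∧ u * v ∉ Ideal.span {g1, g2, g3} := by
  induction j with
  | zero => exact fun k _ u _ hu => ⟨1, isHomogeneous_one _ _, by rwa [mul_one]⟩
  | succ j ih =>
    intro k hk u hu hn
    have : ∃ i : Fin 3, u * X i ∉ Ideal.span {g1, g2, g3} := by
      by_contra! hc
      exact hn (socle h h1 h2 h3 (by omega) hu hc)
    obtain ⟨i, hi⟩ := this
    obtain ⟨v, hv, hv'⟩ := ih (k + 1) (by omega) _ (hu.mul (isHomogeneous_X ℂ i)) hi
    exact ⟨X i * v, by simpa [add_comm] using (isHomogeneous_X ℂ i).mul hv, by rwa [← mul_assoc]⟩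

/-! ### Hilbert functions -/

/-- Degree `n` part of an ideal. -/
noncomputable def part (I : Ideal S) (n : ℕ) : Submodule ℂ S :=
  I.restrictScalars ℂ ⊓ homogeneousSubmodule (Fin 3) ℂ n

instance (n : ℕ) : FiniteDimensional ℂ (homogeneousSubmodule (Fin 3) ℂ n) :=
  Module.Finite.iff_fg.2 (homogeneousSubmodule_fg (Fin 3) ℂ n)

instance (I : Ideal S) (n : ℕ) : FiniteDimensional ℂ (part I n) :=
  Submodule.finiteDimensional_of_le (inf_le_right : part I n ≤ homogeneousSubmodule (Fin 3) ℂ n)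

/-- The ideal is stable under taking components. -/
def Stable (I : Ideal S) : Prop := ∀ p ∈ I, ∀ n, homogeneousComponent n p ∈ I

lemma stable_sup {I : Ideal S} (hI : Stable I) {g : S} {e : ℕ} (hg : g.IsHomogeneous e) :
    Stable (I ⊔ Ideal.span {g}) := by
  intro p hp n
  obtain ⟨i, hi, q, hq, rfl⟩ := Submodule.mem_sup.1 hp
  obtain ⟨a, rfl⟩ := Ideal.mem_span_singleton'.1 hq
  rw [map_add, hc_mul e n _ _ hg]
  exact Submodule.mem_sup.2 ⟨_, hI i hi n, _, Ideal.mem_span_singleton'.2 ⟨_, rfl⟩, rfl⟩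

lemma part_low {I : Ideal S} (hI : Stable I) {g : S} {e : ℕ} (hg : g.IsHomogeneous e)
    {n : ℕ} (hn : n < e) : part (I ⊔ Ideal.span {g}) n = part I n := by
  apply le_antisymm
  · rintro p ⟨hp, hpn⟩
    refine ⟨?_, hpn⟩
    obtain ⟨i, hi, q, hq, rfl⟩ := Submodule.mem_sup.1 hp
    obtain ⟨a, rfl⟩ := Ideal.mem_span_singleton'.1 hq
    have h := homogeneousComponent_eq_self hpn
    rw [map_add, hc_mul e n _ _ hg, pr, if_neg (by omega), zero_mul, add_zero] at h
    rw [← h]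
    exact hI i hi n
  · rintro p ⟨hp, hpn⟩
    exact ⟨Submodule.mem_sup_left (S := I) hp, hpn⟩

lemma finrank_map_inj {V W : Type*} [AddCommGroup V] [Module ℂ V] [AddCommGroup W] [Module ℂ W]
    (f : V →ₗ[ℂ] W) (hf : Function.Injective f) (p : Submodule ℂ V) :
    finrank ℂ (p.map f) = finrank ℂ p :=
  (Submodule.equivMapOfInjective f hf p).finrank_eq.symm

/-- Multiplication by `g`. -/
noncomputable def mulg (g : S) : S →ₗ[ℂ] S := LinearMap.mulRight ℂ g

lemma part_high {I : Ideal S} (hI : Stable I) {g : S} {e : ℕ} (hg : g.IsHomogeneous e)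
    (hg0 : g ≠ 0) (hnz : ∀ p, p * g ∈ I → p ∈ I) (n : ℕ) :
    finrank ℂ (part (I ⊔ Ideal.span {g}) (n + e)) + finrank ℂ (part I n) =
      finrank ℂ (part I (n + e)) + finrank ℂ (homogeneousSubmodule (Fin 3) ℂ n) := by
  have inj : Function.Injective (mulg g) := by
    intro a b hab
    exact mul_right_cancel₀ hg0 hab
  have e1 : part (I ⊔ Ideal.span {g}) (n + e) =
      part I (n + e) ⊔ (homogeneousSubmodule (Fin 3) ℂ n).map (mulg g) := by
    apply le_antisymm
    · rintro p ⟨hp, hpn⟩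
      obtain ⟨i, hi, q, hq, rfl⟩ := Submodule.mem_sup.1 hp
      obtain ⟨a, rfl⟩ := Ideal.mem_span_singleton'.1 hq
      have h := homogeneousComponent_eq_self hpn
      rw [map_add, hc_mul e _ _ _ hg, pr, if_pos (by omega), Nat.add_sub_cancel] at h
      rw [← h]
      exact Submodule.add_mem_sup ⟨hI i hi _, homogeneousComponent_isHomogeneous _ _⟩
        ⟨_, homogeneousComponent_isHomogeneous _ _, rfl⟩
    · apply sup_le
      · rintro p ⟨hp, hpn⟩
        exact ⟨Submodule.mem_sup_left (S := I) hp, hpn⟩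
      · rintro _ ⟨a, ha, rfl⟩
        exact ⟨Submodule.mem_sup_right (S := I) (Ideal.mem_span_singleton'.2 ⟨a, rfl⟩),
          IsHomogeneous.mul ha hg⟩
  have e2 : part I (n + e) ⊓ (homogeneousSubmodule (Fin 3) ℂ n).map (mulg g) =
      (part I n).map (mulg g) := by
    apply le_antisymm
    · rintro _ ⟨⟨hp, _⟩, ⟨a, ha, rfl⟩⟩
      exact ⟨a, ⟨hnz a hp, ha⟩, rfl⟩
    · rintro _ ⟨a, ⟨ha, ha'⟩, rfl⟩
      exact ⟨⟨Ideal.mul_mem_right (I := I) _ ha, IsHomogeneous.mul ha' hg⟩, ⟨a, ha', rfl⟩⟩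
  have := Submodule.finrank_sup_add_finrank_inf_eq (part I (n + e))
    ((homogeneousSubmodule (Fin 3) ℂ n).map (mulg g))
  rw [← e1, e2, finrank_map_inj _ inj, finrank_map_inj _ inj] at this
  exact this

/-- Graded piece of the quotient. -/
noncomputable def qpart (I : Ideal S) (n : ℕ) : Submodule ℂ (S ⧸ I) :=
  Submodule.map (Ideal.Quotient.mkₐ ℂ I).toLinearMap (homogeneousSubmodule (Fin 3) ℂ n)

lemma qpart_part (I : Ideal S) (n : ℕ) :
    finrank ℂ (qpart I n) + finrank ℂ (part I n) =
      finrank ℂ (homogeneousSubmodule (Fin 3) ℂ n) := by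
  have := LinearMap.finrank_range_add_finrank_ker
    ((Ideal.Quotient.mkₐ ℂ I).toLinearMap.domRestrict (homogeneousSubmodule (Fin 3) ℂ n))
  rw [LinearMap.range_domRestrict] at this
  rw [← this]
  congr 1
  rw [← finrank_map_inj (homogeneousSubmodule (Fin 3) ℂ n).subtype Subtype.val_injective]
  suffices hh : part I n = Submodule.map (homogeneousSubmodule (Fin 3) ℂ n).subtype
      (LinearMap.ker ((Ideal.Quotient.mkₐ ℂ I).toLinearMap.domRestrict
        (homogeneousSubmodule (Fin 3) ℂ n))) by rw [hh]
  ext p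
  constructor
  · rintro ⟨hp, hpn⟩
    exact ⟨⟨p, hpn⟩, Ideal.Quotient.eq_zero_iff_mem.2 hp, rfl⟩
  · rintro ⟨⟨q, hq⟩, hp, rfl⟩
    exact ⟨Ideal.Quotient.eq_zero_iff_mem.1 hp, hq⟩

/-- Hilbert function extended to the integers. -/
noncomputable def H (I : Ideal S) (m : ℤ) : ℤ :=
  if 0 ≤ m then (finrank ℂ (qpart I m.toNat) : ℤ) else 0

lemma H_step {I : Ideal S} (hI : Stable I) {g : S} {e : ℕ} (hg : g.IsHomogeneous e)
    (hg0 : g ≠ 0) (hnz : ∀ p, p * g ∈ I → p ∈ I) (m : ℤ) :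
    H (I ⊔ Ideal.span {g}) m = H I m - H I (m - e) := by
  unfold H
  by_cases h0 : 0 ≤ m
  · lift m to ℕ using h0
    by_cases h1 : e ≤ m
    · obtain ⟨n, rfl⟩ := Nat.exists_eq_add_of_le' h1
      rw [if_pos (by positivity), if_pos (by positivity), if_pos (by omega)]
      have t1 : ((n + e : ℕ) : ℤ).toNat = n + e := by omega
      have t2 : (((n + e : ℕ) : ℤ) - e).toNat = n := by omega
      rw [t1, t2]
      have := part_high hI hg hg0 hnz n
      have a1 := qpart_part I n
      have a2 := qpart_part I (n + e)
      have a3 := qpart_part (I ⊔ Ideal.span {g}) (n + e)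
      omega
    · rw [if_pos (by positivity), if_pos (by positivity), if_neg (by omega)]
      have t1 : (m : ℤ).toNat = m := by omega
      rw [t1]
      have := part_low hI hg (n := m) (by omega)
      have a2 := qpart_part I m
      have a3 := qpart_part (I ⊔ Ideal.span {g}) m
      rw [this] at a3
      omega
  · rw [if_neg h0, if_neg h0, if_neg (by omega)]
    simp

lemma finrank_hom (n : ℕ) :
    finrank ℂ (homogeneousSubmodule (Fin 3) ℂ n) = (n + 2).choose 2 := by
  rw [homogeneousSubmodule_eq_finsupp_supported]
  have : {d : Fin 3 →₀ ℕ | d.degree = n} =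
      ((Finset.finsuppAntidiag (Finset.univ : Finset (Fin 3)) n : Finset _) : Set _) := by
    ext d
    simp [Finsupp.degree_eq_sum]
  rw [this, (AddMonoidAlgebra.supportedEquivFinsupp _).finrank_eq, finrank_finsupp_self]
  rw [← Nat.card_eq_fintype_card, Nat.card_coe_set_eq, Set.ncard_coe_finset,
    Finset.card_finsuppAntidiag_nat_eq_choose]
  have h3 : (Finset.univ : Finset (Fin 3)).card + n - 1 = n + 2 := by
    rw [Finset.card_univ, Fintype.card_fin]
    omega
  rw [h3, ← Nat.choose_symm_add]

lemma H_bot (m : ℤ) : 2 * H ⊥ m = if 0 ≤ m then (m + 1) * (m + 2) else 0 := by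
  unfold H
  split_ifs with h
  · lift m to ℕ using h
    have a := qpart_part ⊥ m
    have b : part ⊥ m = ⊥ := by
      rw [eq_bot_iff]
      rintro p ⟨hp, -⟩
      exact hp
    rw [b, finrank_bot, add_zero, finrank_hom] at a
    rw [Int.toNat_natCast, a]
    have := Nat.choose_two_right (m + 2)
    have h2 := Nat.div_mul_cancel (Nat.even_mul_pred_self (m + 2)).two_dvd
    rw [← this] at h2
    have h3 : m + 2 - 1 = m + 1 := by omega
    rw [h3] at h2
    zify at h2
    linear_combination h2
  · simp

lemma H_bot_symm (m : ℤ) : 2 * H ⊥ m + 2 * H ⊥ (-3 - m) = (m + 1) * (m + 2) := by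
  rw [H_bot, H_bot]
  split_ifs with h1 h2 h2
  · omega
  · ring
  · ring
  · obtain rfl | rfl : m = -1 ∨ m = -2 := by omega
    · norm_num
    · norm_num

lemma H_symm {e : ℕ} {g1 g2 g3 : S} (h : Reg3 g1 g2 g3)
    (n1 : g1 ≠ 0) (n2 : g2 ≠ 0) (n3 : g3 ≠ 0)
    (h1 : g1.IsHomogeneous e) (h2 : g2.IsHomogeneous e) (h3 : g3.IsHomogeneous e) (m : ℤ) :
    H (Ideal.span {g1, g2, g3}) m = H (Ideal.span {g1, g2, g3}) (3 * e - 3 - m) := by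
  have s0 : Stable ⊥ := by
    intro p hp n
    rw [Ideal.mem_bot] at hp
    rw [hp, map_zero]
    exact zero_mem _
  have s1 := stable_sup s0 h1
  have s2 := stable_sup s1 h2
  have E1 (m : ℤ) := H_step s0 h1 n1 (by simpa using h.r1) m
  have E2 (m : ℤ) := H_step s1 h2 n2 (by
    intro p hp
    rw [bot_sup_eq, Ideal.mem_span_singleton'] at hp ⊢
    obtain ⟨q, hq⟩ := hp
    obtain ⟨r, hr⟩ := h.r2 p q hq.symm
    exact ⟨r, hr.symm⟩) m
  have e2 : (⊥ ⊔ Ideal.span {g1} ⊔ Ideal.span {g2} : Ideal S) = Ideal.span {g1, g2} := by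
    rw [bot_sup_eq, ← Ideal.span_insert]
  have E3 (m : ℤ) := H_step s2 h3 n3 (by
    intro p hp
    rw [e2, Ideal.mem_span_pair] at hp ⊢
    obtain ⟨q, r, hq⟩ := hp
    obtain ⟨s, t, hr⟩ := h.r3 p q r hq.symm
    exact ⟨s, t, hr.symm⟩) m
  have e3 : (⊥ ⊔ Ideal.span {g1} ⊔ Ideal.span {g2} ⊔ Ideal.span {g3} : Ideal S) =
      Ideal.span {g1, g2, g3} := by
    rw [bot_sup_eq, Ideal.span_insert, Ideal.span_insert, sup_assoc]
  rw [← e3]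
  simp only [E3, E2, E1]
  have q0 := H_bot_symm m
  have q1 := H_bot_symm (m - e)
  have q2 := H_bot_symm (m - e - e)
  have q3 := H_bot_symm (m - e - e - e)
  have t0 : 3 * (e : ℤ) - 3 - m - e - e - e = -3 - m := by ring
  have t1 : 3 * (e : ℤ) - 3 - m - e - e = -3 - (m - e) := by ring
  have t2 : 3 * (e : ℤ) - 3 - m - e = -3 - (m - e - e) := by ring
  have t3 : 3 * (e : ℤ) - 3 - m = -3 - (m - e - e - e) := by ring
  rw [t0, t1, t2, t3]
  have : (2 : ℤ) ≠ 0 := by norm_num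
  apply mul_left_cancel₀ this
  linear_combination q0 - 3 * q1 + 3 * q2 - q3

lemma reg_of_isRegular {g1 g2 g3 : S}
    (hreg : RingTheory.Sequence.IsRegular S [g1, g2, g3]) : Reg3 g1 g2 g3 := by
  have key (I : Ideal S) (g : S) (hh : IsSMulRegular (S ⧸ (I • ⊤ : Submodule S S)) g)
      (p : S) (hp : p * g ∈ I) : p ∈ I := by
    have hI : (I • ⊤ : Submodule S S) = I := by simp
    rw [hI] at hh
    have : g • (Submodule.Quotient.mk p : S ⧸ I) = g • 0 := by
      rw [smul_zero, ← Submodule.Quotient.mk_smul, Submodule.Quotient.mk_eq_zero, smul_eq_mul,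
        mul_comm]
      exact hp
    exact (Submodule.Quotient.mk_eq_zero _).1 (hh this)
  have k0 := key _ _ (hreg.regular_mod_prev 0 (by simp))
  have k1 := key _ _ (hreg.regular_mod_prev 1 (by simp))
  have k2 := key _ _ (hreg.regular_mod_prev 2 (by simp))
  simp only [List.take_zero, List.take_succ_cons, List.getElem_cons_zero,
    List.getElem_cons_succ, Ideal.ofList_nil, Ideal.ofList_cons, Ideal.mem_bot, sup_bot_eq,
    ← Ideal.span_insert, Ideal.mem_span_pair, Ideal.mem_span_singleton'] at k0 k1 k2
  refine ⟨k0, fun p q h => ?_, fun p q r h => ?_⟩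
  · obtain ⟨r, hr⟩ := k1 p ⟨q, h.symm⟩
    exact ⟨r, hr.symm⟩
  · obtain ⟨s, t, hr⟩ := k2 p ⟨q, r, h.symm⟩
    exact ⟨s, t, hr.symm⟩

end JacPair



/-- Macaulay's theorem: for the Jacobian ring `R = ℂ[x,y,z]/(f_x,f_y,f_z)` of a form `f` of
degree `d ≥ 2` whose partials are a regular sequence, and `0 ≤ k ≤ N = 3(d-2)`, the
multiplication pairing `R^k × R^{N-k} → R^N ≅ ℂ` is perfect: it is nondegenerate on both
sides and in particular `dim R^k = dim R^{N-k}`. -/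
theorem jacobian_ring_perfect_pairing (d : ℕ) (hd : 2 ≤ d)
    (f : MvPolynomial (Fin 3) ℂ) (hf : f.IsHomogeneous d)
    (hreg : RingTheory.Sequence.IsRegular (MvPolynomial (Fin 3) ℂ)
      [pderiv 0 f, pderiv 1 f, pderiv 2 f])
    (k : ℕ) (hk : k ≤ 3 * (d - 2)) :
    let S := MvPolynomial (Fin 3) ℂ
    let J : Ideal S := Ideal.span {pderiv 0 f, pderiv 1 f, pderiv 2 f}
    let mk := (Ideal.Quotient.mkₐ ℂ J).toLinearMap
    let Rk := Submodule.map mk (homogeneousSubmodule (Fin 3) ℂ k)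
    let Rk' := Submodule.map mk (homogeneousSubmodule (Fin 3) ℂ (3 * (d - 2) - k))
    (∀ x ∈ Rk, x ≠ 0 → ∃ y ∈ Rk', x * y ≠ 0) ∧
    (∀ y ∈ Rk', y ≠ 0 → ∃ x ∈ Rk, x * y ≠ 0) ∧
    finrank ℂ Rk = finrank ℂ Rk' := by
  intro S J mk Rk Rk'
  have hr := JacPair.reg_of_isRegular hreg
  have h1 : (pderiv 0 f).IsHomogeneous (d - 1) := hf.pderiv
  have h2 : (pderiv 1 f).IsHomogeneous (d - 1) := hf.pderiv
  have h3 : (pderiv 2 f).IsHomogeneous (d - 1) := hf.pderiv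
  have hJ : Ideal.span {pderiv 0 f, pderiv 1 f, pderiv 2 f} ≠ (⊤ : Ideal S) := by
    intro ht
    apply hreg.top_ne_smul
    rw [smul_eq_mul, Ideal.mul_top, ← ht]
    simp [Ideal.ofList_cons, Ideal.span_insert]
  have nd (a b : ℕ) (hab : a + b = 3 * (d - 2)) (x : S ⧸ J)
      (hx : x ∈ Submodule.map mk (homogeneousSubmodule (Fin 3) ℂ a)) (hx0 : x ≠ 0) :
      ∃ y ∈ Submodule.map mk (homogeneousSubmodule (Fin 3) ℂ b), x * y ≠ 0 := by
    obtain ⟨u, hu, rfl⟩ := hx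
    obtain ⟨v, hv, huv⟩ := JacPair.nondeg hr h1 h2 h3 b a (by omega) u hu
      (fun hmem => hx0 (Ideal.Quotient.eq_zero_iff_mem.2 hmem))
    refine ⟨mk v, ⟨v, hv, rfl⟩, fun h0 => huv ?_⟩
    exact Ideal.Quotient.eq_zero_iff_mem.1 h0
  refine ⟨nd k _ (by omega), ?_, ?_⟩
  · intro y hy hy0
    obtain ⟨x, hx, hxy⟩ := nd _ k (by omega) y hy hy0
    exact ⟨x, hx, by rwa [mul_comm]⟩
  · have n1 : pderiv 0 f ≠ 0 := by
      intro h0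
      exact one_ne_zero (hr.r1 1 (by rw [h0, mul_zero]))
    have n2 : pderiv 1 f ≠ 0 := by
      intro h0
      obtain ⟨r, h⟩ := hr.r2 1 0 (by rw [h0, mul_zero, zero_mul])
      apply hJ
      rw [Ideal.eq_top_iff_one]
      exact JacPair.mem3.2 ⟨r, 0, 0, by rw [h]; ring⟩
    have n3 : pderiv 2 f ≠ 0 := by
      intro h0
      obtain ⟨r, t, h⟩ := hr.r3 1 0 0 (by rw [h0]; ring)
      apply hJ
      rw [Ideal.eq_top_iff_one]
      exact JacPair.mem3.2 ⟨r, t, 0, by rw [h]; ring⟩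
    have hs := JacPair.H_symm hr n1 n2 n3 h1 h2 h3 k
    have t1 : 3 * ((d - 1 : ℕ) : ℤ) - 3 - k = ((3 * (d - 2) - k : ℕ) : ℤ) := by omega
    rw [t1] at hs
    unfold JacPair.H at hs
    rw [if_pos (by positivity), if_pos (by positivity), Int.toNat_natCast,
      Int.toNat_natCast] at hs
    exact_mod_cast hs
end

section
/- Let S = ℂ[x,y,z] and let W ⊆ S^a be a linear subspace of codimension c such that the common zero locus of W in ℙ² is empty (W is base-point-free). If m ≥ c, then the multiplication map W ⊗ S^m → S^{m+a} is surjective. -/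
open MvPolynomial Module

section GreenLine
open Polynomial

/-- multiplication by the variable -/
noncomputable def gmX : ℂ[X] →ₗ[ℂ] ℂ[X] := LinearMap.mulLeft ℂ (Polynomial.X : ℂ[X])

lemma gmX_apply (p : ℂ[X]) : gmX p = Polynomial.X * p := rfl

lemma gmX_inj : Function.Injective gmX := by
  intro p q h
  exact mul_left_cancel₀ Polynomial.X_ne_zero h

lemma g_fd {N : ℕ} {U : Submodule ℂ ℂ[X]} (h : U ≤ degreeLT ℂ N) : FiniteDimensional ℂ U :=
  Submodule.finiteDimensional_of_le h

lemma gmX_le {N : ℕ} {U : Submodule ℂ ℂ[X]} (h : U ≤ degreeLT ℂ N) :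
    U.map gmX ≤ degreeLT ℂ (N + 1) := by
  rintro _ ⟨p, hp, rfl⟩
  have := h hp
  rw [Polynomial.mem_degreeLT] at this ⊢
  by_cases h0 : p = 0
  · subst h0; simp [gmX_apply]
  rw [gmX_apply, mul_comm, Polynomial.degree_mul_X]
  rw [Polynomial.degree_eq_natDegree h0] at this ⊢
  norm_cast at this ⊢
  omega

lemma g_sup_le {N : ℕ} {U : Submodule ℂ ℂ[X]} (h : U ≤ degreeLT ℂ N) :
    U ⊔ U.map gmX ≤ degreeLT ℂ (N + 1) :=
  sup_le (h.trans (Polynomial.degreeLT_mono (by omega))) (gmX_le h)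

lemma line_growth {N : ℕ} {U : Submodule ℂ ℂ[X]} (h : U ≤ degreeLT ℂ N) (hU : U ≠ ⊥) :
    finrank ℂ U + 1 ≤ finrank ℂ (U ⊔ U.map gmX : Submodule ℂ ℂ[X]) := by
  have := g_fd (g_sup_le h)
  have hlt : U < U ⊔ U.map gmX := by
    refine lt_of_le_of_ne le_sup_left ?_
    intro he
    have hX : ∀ p ∈ U, gmX p ∈ U := by
      intro p hp
      rw [he]
      exact Submodule.mem_sup_right (Submodule.mem_map_of_mem hp)
    obtain ⟨p, hp, hp0⟩ := Submodule.exists_mem_ne_zero_of_ne_bot hU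
    have hk : ∀ k : ℕ, Polynomial.X ^ k * p ∈ U := by
      intro k
      induction k with
      | zero => simpa using hp
      | succ k ih =>
        have := hX _ ih
        rw [gmX_apply, ← mul_assoc, ← pow_succ'] at this
        exact this
    have h1 := h (hk N)
    rw [Polynomial.mem_degreeLT, Polynomial.degree_mul, Polynomial.degree_X_pow,
      Polynomial.degree_eq_natDegree hp0] at h1
    norm_cast at h1
    omega
  exact Submodule.finrank_lt_finrank_of_lt hlt

lemma line_str (n : ℕ) : ∀ (N : ℕ) (U : Submodule ℂ ℂ[X]), U ≤ degreeLT ℂ N →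
    finrank ℂ U = n + 1 → finrank ℂ (U ⊔ U.map gmX : Submodule ℂ ℂ[X]) ≤ n + 2 →
    ∃ w : ℂ[X], w ≠ 0 ∧ ∀ u ∈ U, ∃ q ∈ degreeLT ℂ (n + 1), u = w * q := by
  induction n with
  | zero =>
    intro N U h h1 h2
    obtain ⟨v, hv, hv'⟩ := finrank_eq_one_iff'.1 h1
    refine ⟨v, by simpa using hv, fun u hu => ?_⟩
    obtain ⟨c, hc⟩ := hv' ⟨u, hu⟩
    refine ⟨Polynomial.C c, ?_, ?_⟩
    · rw [Polynomial.mem_degreeLT]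
      exact lt_of_le_of_lt Polynomial.degree_C_le (by norm_num)
    · have := congrArg Subtype.val hc
      simp only [Submodule.coe_smul] at this
      rw [← this, Polynomial.smul_eq_C_mul, mul_comm]
  | succ n ih =>
    intro N U h h1 h2
    have fU := g_fd h
    have fXU := g_fd (gmX_le h)
    set U' : Submodule ℂ ℂ[X] := U ⊓ U.comap gmX with hU'
    have hU'U : U' ≤ U := inf_le_left
    have e1 : U'.map gmX = U ⊓ U.map gmX := by
      ext p
      constructor
      · rintro ⟨q, hq, rfl⟩
        exact ⟨hq.2, Submodule.mem_map_of_mem hq.1⟩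
      · rintro ⟨hp, q, hq, rfl⟩
        exact ⟨q, ⟨hq, hp⟩, rfl⟩
    have e2 : finrank ℂ (U'.map gmX) = finrank ℂ U' :=
      (Submodule.equivMapOfInjective gmX gmX_inj _).finrank_eq.symm
    have e3 : finrank ℂ (U.map gmX) = finrank ℂ U :=
      (Submodule.equivMapOfInjective gmX gmX_inj _).finrank_eq.symm
    have e4 := Submodule.finrank_sup_add_finrank_inf_eq U (U.map gmX)
    rw [← e1, e2, e3] at e4
    have hle : U' ⊔ U'.map gmX ≤ U := sup_le hU'U (by rw [e1]; exact inf_le_left)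
    have hne : U' ≠ ⊥ := by
      intro hb
      rw [hb, finrank_bot] at e4
      omega
    have e5 := line_growth (hU'U.trans h) hne
    have e6 := Submodule.finrank_mono hle
    have e7 : U' ⊔ U'.map gmX = U := Submodule.eq_of_le_of_finrank_eq hle (by omega)
    obtain ⟨w, hw, hw'⟩ := ih N U' (hU'U.trans h) (by omega) (by omega)
    refine ⟨w, hw, fun u hu => ?_⟩
    rw [← e7] at hu
    obtain ⟨y, hy, z, hz, rfl⟩ := Submodule.mem_sup.1 hu
    obtain ⟨v, hv, rfl⟩ := hz
    obtain ⟨q1, hq1, rfl⟩ := hw' y hy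
    obtain ⟨q2, hq2, rfl⟩ := hw' v hv
    refine ⟨q1 + gmX q2, ?_, ?_⟩
    · exact add_mem (Polynomial.degreeLT_mono (by omega) hq1)
        (gmX_le le_rfl (Submodule.mem_map_of_mem hq2))
    · rw [gmX_apply, gmX_apply]; ring

lemma line_strict {x : ℕ} {U : Submodule ℂ ℂ[X]} (h : U ≤ degreeLT ℂ (x + 1))
    (hb : ∀ t : ℂ, ∃ u ∈ U, u.eval t ≠ 0) (hi : ∃ u ∈ U, u.coeff x ≠ 0)
    (hlt : finrank ℂ U < x + 1) :
    finrank ℂ U + 2 ≤ finrank ℂ (U ⊔ U.map gmX : Submodule ℂ ℂ[X]) := by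
  have fU := g_fd h
  by_contra hcon
  have hpos : finrank ℂ U ≠ 0 := by
    intro h0
    obtain ⟨u, hu, hu'⟩ := hi
    rw [Submodule.finrank_eq_zero] at h0
    rw [h0, Submodule.mem_bot] at hu
    simp [hu] at hu'
  obtain ⟨n, hn⟩ := Nat.exists_eq_succ_of_ne_zero hpos
  obtain ⟨w, hw, hw'⟩ := line_str n (x + 1) U h hn (by omega)
  have hdeg : w.degree = 0 := by
    by_contra hd
    obtain ⟨t, ht⟩ := IsAlgClosed.exists_root w hd
    obtain ⟨u, hu, hu'⟩ := hb t
    obtain ⟨q, -, rfl⟩ := hw' u hu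
    apply hu'
    rw [Polynomial.eval_mul, ht.eq_zero, zero_mul]
  obtain ⟨u, hu, hu'⟩ := hi
  obtain ⟨q, hq, rfl⟩ := hw' u hu
  apply hu'
  apply Polynomial.coeff_eq_zero_of_degree_lt
  rw [Polynomial.degree_mul, hdeg, zero_add]
  refine lt_of_lt_of_le (Polynomial.mem_degreeLT.1 hq) ?_
  norm_cast
  omega

/-- A graded family of spaces of binary forms. -/
structure LineFam (a : ℕ) (J : ℕ → Submodule ℂ ℂ[X]) : Prop where
  le : ∀ x, J x ≤ degreeLT ℂ (x + 1)
  one : ∀ x, J x ≤ J (x + 1)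
  mulX : ∀ x, ∀ p ∈ J x, Polynomial.X * p ∈ J (x + 1)
  bpf : ∀ t : ℂ, ∃ u ∈ J a, u.eval t ≠ 0
  inf : ∃ u ∈ J a, u.coeff a ≠ 0

variable {a : ℕ} {J : ℕ → Submodule ℂ ℂ[X]}

lemma LineFam.sup_le (h : LineFam a J) (x : ℕ) : J x ⊔ (J x).map gmX ≤ J (x + 1) :=
  _root_.sup_le (h.one x) (by rintro _ ⟨p, hp, rfl⟩; exact h.mulX x p hp)

lemma finrank_degLT (n : ℕ) : finrank ℂ (degreeLT ℂ n) = n := by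
  rw [(Polynomial.degreeLTEquiv ℂ n).finrank_eq]; simp

lemma LineFam.bound (h : LineFam a J) (x : ℕ) : finrank ℂ (J x) ≤ x + 1 := by
  have := Submodule.finrank_mono (h.le x)
  rwa [finrank_degLT] at this

lemma LineFam.mono (h : LineFam a J) {x y : ℕ} (hxy : x ≤ y) (hx : 1 ≤ finrank ℂ (J x)) :
    finrank ℂ (J x) + (y - x) ≤ finrank ℂ (J y) := by
  induction y, hxy using Nat.le_induction with
  | base => simp
  | succ y hxy ih =>
    have f1 := g_fd (h.le (y + 1))
    have hne : J y ≠ ⊥ := by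
      intro hb
      rw [hb, finrank_bot] at ih
      omega
    have h1 := line_growth (h.le y) hne
    have h2 := Submodule.finrank_mono (h.sup_le y)
    omega

lemma LineFam.pos (h : LineFam a J) : 1 ≤ finrank ℂ (J a) := by
  have f1 := g_fd (h.le a)
  by_contra h0
  have h0 : finrank ℂ (J a) = 0 := by omega
  obtain ⟨u, hu, hu'⟩ := h.inf
  rw [Submodule.finrank_eq_zero] at h0
  rw [h0, Submodule.mem_bot] at hu
  simp [hu] at hu'

lemma LineFam.bpf' (h : LineFam a J) (k : ℕ) :
    (∀ t : ℂ, ∃ u ∈ J (a + k), u.eval t ≠ 0) ∧ ∃ u ∈ J (a + k), u.coeff (a + k) ≠ 0 := by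
  induction k with
  | zero => exact ⟨h.bpf, h.inf⟩
  | succ k ih =>
    refine ⟨fun t => ?_, ?_⟩
    · obtain ⟨u, hu, hu'⟩ := ih.1 t
      exact ⟨u, h.one _ hu, hu'⟩
    · obtain ⟨u, hu, hu'⟩ := ih.2
      refine ⟨Polynomial.X * u, h.mulX _ _ hu, ?_⟩
      rwa [← add_assoc, Polynomial.coeff_X_mul]

lemma LineFam.strict (h : LineFam a J) (k : ℕ) :
    finrank ℂ (J (a + k)) = a + k + 1 ∨
      finrank ℂ (J a) + 2 * k ≤ finrank ℂ (J (a + k)) := by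
  induction k with
  | zero => right; simp
  | succ k ih =>
    have f1 := g_fd (h.le (a + k + 1))
    have b1 := h.bound (a + k + 1)
    have hp := h.pos
    have h2 := Submodule.finrank_mono (h.sup_le (a + k))
    have b0 := h.bound (a + k)
    have hm := h.mono (show a ≤ a + k by omega) hp
    by_cases hlt : finrank ℂ (J (a + k)) < a + k + 1
    · have h3 := line_strict (h.le (a + k)) (h.bpf' k).1 (h.bpf' k).2 hlt
      right
      rw [← add_assoc]
      omega
    · left
      have h4 := h.mono (show a + k ≤ a + k + 1 by omega) (by omega)
      rw [← add_assoc]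
      omega

end GreenLine
section GreenData

abbrev GS := MvPolynomial (Fin 3) ℂ

abbrev Hm (x : ℕ) : Submodule ℂ GS := homogeneousSubmodule (Fin 3) ℂ x

instance Hm_fd (x : ℕ) : FiniteDimensional ℂ (Hm x) :=
  Module.Finite.iff_fg.2 (homogeneousSubmodule_fg (Fin 3) ℂ x)

lemma Hm_mul {x y : ℕ} {p q : GS} (hp : p ∈ Hm x) (hq : q ∈ Hm y) : p * q ∈ Hm (x + y) :=
  MvPolynomial.IsHomogeneous.mul hp hq

lemma Hm_add (x y : ℕ) : Hm (x + y) = Hm x * Hm y := by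
  simp only [Hm]
  rw [← homogeneousSubmodule_one_pow (σ := Fin 3) ℂ (x + y), ← homogeneousSubmodule_one_pow (σ := Fin 3) ℂ x,
    ← homogeneousSubmodule_one_pow (σ := Fin 3) ℂ y, pow_add]

lemma Hm_induction {x : ℕ} {P : GS → Prop} (hadd : ∀ p q, P p → P q → P (p + q))
    (hX : ∀ i, ∀ q ∈ Hm x, P (X i * q)) {p : GS} (hp : p ∈ Hm (x + 1)) : P p := by
  rw [add_comm, Hm_add] at hp
  have h0 : P 0 := by
    have := hX 0 0 (zero_mem _)
    rwa [mul_zero] at this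
  refine Submodule.mul_induction_on hp ?_ (fun p q => hadd p q)
  intro m hm n hn
  have hm' : m ∈ Submodule.span ℂ (Set.range (X : Fin 3 → GS)) := by
    rw [← homogeneousSubmodule_one_eq_span_X]; exact hm
  suffices ∀ n ∈ Hm x, P (m * n) from this n hn
  clear hn n
  induction hm' using Submodule.span_induction with
  | mem y hy => obtain ⟨i, rfl⟩ := hy; exact hX i
  | zero => intro n _; rwa [zero_mul]
  | add y z hy hz h1 h2 =>
    intro n hn
    rw [add_mul]
    exact hadd _ _ (h1 (by simpa [homogeneousSubmodule_one_eq_span_X, Hm] using hy) n hn)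
      (h2 (by simpa [homogeneousSubmodule_one_eq_span_X, Hm] using hz) n hn)
  | smul c y hy h1 =>
    intro n hn
    rw [smul_mul_assoc, ← mul_smul_comm]
    exact h1 (by simpa [homogeneousSubmodule_one_eq_span_X, Hm] using hy) _
      (Submodule.smul_mem _ _ hn)

/-- coordinates on the line `l = 0` -/
structure LD (l : GS) where
  s : GS
  t : GS
  π : GS →ₐ[ℂ] Polynomial ℂ
  b : Fin 3 → ℂ
  e : Fin 3 → ℂ
  g : Fin 3 → ℂ
  hl : l ∈ Hm 1
  l0 : l ≠ 0
  hs : s ∈ Hm 1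
  ht : t ∈ Hm 1
  hX : ∀ i, X i = C (b i) * s + C (e i) * t + C (g i) * l
  πX : ∀ i, π (X i) = Polynomial.C (b i) + Polynomial.C (e i) * Polynomial.X
  πl : π l = 0
  πs : π s = 1
  πt : π t = Polynomial.X

/-- the linear form with given coefficients -/
noncomputable def linf (v : Fin 3 → ℂ) : GS := C (v 0) * X 0 + C (v 1) * X 1 + C (v 2) * X 2

lemma X_mem (i : Fin 3) : (X i : GS) ∈ Hm 1 := isHomogeneous_X ℂ i

lemma CX_mem (c : ℂ) (i : Fin 3) : (C c * X i : GS) ∈ Hm 1 := isHomogeneous_C_mul_X c i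

lemma linf_mem (v : Fin 3 → ℂ) : linf v ∈ Hm 1 :=
  add_mem (add_mem (CX_mem _ _) (CX_mem _ _)) (CX_mem _ _)

lemma linf_ne (v : Fin 3 → ℂ) (hv : v ≠ 0) : linf v ≠ 0 := by
  intro h
  apply hv
  funext i
  have h1 := congrArg (eval (Pi.single i (1 : ℂ))) h
  fin_cases i <;> simpa [linf] using h1

lemma exists_LD (v : Fin 3 → ℂ) (hv : v ≠ 0) : Nonempty (LD (linf v)) := by
  have hv' : v 0 ≠ 0 ∨ v 1 ≠ 0 ∨ v 2 ≠ 0 := by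
    by_contra h
    push Not at h
    apply hv
    funext i
    fin_cases i
    · exact h.1
    · exact h.2.1
    · exact h.2.2
  rcases hv' with h | h | h
  · have hC : (C (v 0)⁻¹ * C (v 0) : GS) = 1 := by rw [← C_mul, inv_mul_cancel₀ h, C_1]
    have hP : (Polynomial.C (v 0) * Polynomial.C (v 0)⁻¹ : Polynomial ℂ) = 1 := by
      rw [← Polynomial.C_mul, mul_inv_cancel₀ h, Polynomial.C_1]
    refine ⟨⟨X 1, X 2, aeval (fun i => Polynomial.C (![-(v 1) * (v 0)⁻¹, 1, 0] i)
        + Polynomial.C (![-(v 2) * (v 0)⁻¹, 0, 1] i) * Polynomial.X),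
      ![-(v 1) * (v 0)⁻¹, 1, 0], ![-(v 2) * (v 0)⁻¹, 0, 1], ![(v 0)⁻¹, 0, 0],
      linf_mem v, linf_ne v hv, X_mem _, X_mem _, ?_, ?_, ?_, ?_, ?_⟩⟩
    · intro i
      fin_cases i
      · simp [linf]
        linear_combination (-X 0) * hC
      · simp
      · simp
    · intro i; simp
    · simp [linf]
      linear_combination (-Polynomial.C (v 1) - Polynomial.C (v 2) * Polynomial.X) * hP
    · simp
    · simp
  · have hC : (C (v 1)⁻¹ * C (v 1) : GS) = 1 := by rw [← C_mul, inv_mul_cancel₀ h, C_1]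
    have hP : (Polynomial.C (v 1) * Polynomial.C (v 1)⁻¹ : Polynomial ℂ) = 1 := by
      rw [← Polynomial.C_mul, mul_inv_cancel₀ h, Polynomial.C_1]
    refine ⟨⟨X 0, X 2, aeval (fun i => Polynomial.C (![1, -(v 0) * (v 1)⁻¹, 0] i)
        + Polynomial.C (![0, -(v 2) * (v 1)⁻¹, 1] i) * Polynomial.X),
      ![1, -(v 0) * (v 1)⁻¹, 0], ![0, -(v 2) * (v 1)⁻¹, 1], ![0, (v 1)⁻¹, 0],
      linf_mem v, linf_ne v hv, X_mem _, X_mem _, ?_, ?_, ?_, ?_, ?_⟩⟩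
    · intro i
      fin_cases i
      · simp
      · simp [linf]
        linear_combination (-X 1) * hC
      · simp
    · intro i; simp
    · simp [linf]
      linear_combination (-Polynomial.C (v 0) - Polynomial.C (v 2) * Polynomial.X) * hP
    · simp
    · simp
  · have hC : (C (v 2)⁻¹ * C (v 2) : GS) = 1 := by rw [← C_mul, inv_mul_cancel₀ h, C_1]
    have hP : (Polynomial.C (v 2) * Polynomial.C (v 2)⁻¹ : Polynomial ℂ) = 1 := by
      rw [← Polynomial.C_mul, mul_inv_cancel₀ h, Polynomial.C_1]
    refine ⟨⟨X 0, X 1, aeval (fun i => Polynomial.C (![1, 0, -(v 0) * (v 2)⁻¹] i)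
        + Polynomial.C (![0, 1, -(v 1) * (v 2)⁻¹] i) * Polynomial.X),
      ![1, 0, -(v 0) * (v 2)⁻¹], ![0, 1, -(v 1) * (v 2)⁻¹], ![0, 0, (v 2)⁻¹],
      linf_mem v, linf_ne v hv, X_mem _, X_mem _, ?_, ?_, ?_, ?_, ?_⟩⟩
    · intro i
      fin_cases i
      · simp
      · simp
      · simp [linf]
        linear_combination (-X 2) * hC
    · intro i; simp
    · simp [linf]
      linear_combination (-Polynomial.C (v 0) - Polynomial.C (v 1) * Polynomial.X) * hP
    · simp
    · simp

variable {l : GS} (L : LD l)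

/-- homogenization -/
noncomputable def LD.hom (x : ℕ) (f : Polynomial ℂ) : GS :=
  ∑ k ∈ Finset.range (x + 1), C (f.coeff k) * (L.s ^ (x - k) * L.t ^ k)

lemma LD.hom_add (x : ℕ) (f f' : Polynomial ℂ) : L.hom x (f + f') = L.hom x f + L.hom x f' := by
  simp [LD.hom, add_mul, Finset.sum_add_distrib]

lemma LD.hom_C (x : ℕ) (c : ℂ) (f : Polynomial ℂ) :
    L.hom x (Polynomial.C c * f) = C c * L.hom x f := by
  simp [LD.hom, Finset.mul_sum, mul_assoc]

lemma LD.hom_X (x : ℕ) (f : Polynomial ℂ) :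
    L.hom (x + 1) (Polynomial.X * f) = L.t * L.hom x f := by
  rw [LD.hom, Finset.sum_range_succ']
  simp only [Polynomial.coeff_X_mul, LD.hom, Finset.mul_sum]
  simp only [Polynomial.mul_coeff_zero, Polynomial.coeff_X_zero, zero_mul, C_0, add_zero]
  refine Finset.sum_congr rfl fun k _ => ?_
  rw [Nat.add_sub_add_right, pow_succ]
  ring

lemma LD.hom_s (x : ℕ) (f : Polynomial ℂ) (hf : f ∈ Polynomial.degreeLT ℂ (x + 1)) :
    L.hom (x + 1) f = L.s * L.hom x f := by
  rw [LD.hom, Finset.sum_range_succ]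
  have h0 : f.coeff (x + 1) = 0 :=
    Polynomial.coeff_eq_zero_of_degree_lt (Polynomial.mem_degreeLT.1 hf)
  simp only [h0, C_0, zero_mul, add_zero, LD.hom, Finset.mul_sum]
  refine Finset.sum_congr rfl fun k hk => ?_
  rw [Finset.mem_range] at hk
  rw [Nat.succ_sub (by omega), pow_succ]
  ring

lemma LD.hom_mem (x : ℕ) (f : Polynomial ℂ) : L.hom x f ∈ Hm x := by
  refine Submodule.sum_mem _ fun k hk => ?_
  rw [Finset.mem_range] at hk
  have h1 := MvPolynomial.IsHomogeneous.pow (show L.s.IsHomogeneous 1 from L.hs) (x - k)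
  have h2 := MvPolynomial.IsHomogeneous.pow (show L.t.IsHomogeneous 1 from L.ht) k
  have h3 := (h1.mul h2).C_mul (f.coeff k)
  have : 1 * (x - k) + 1 * k = x := by omega
  rw [this] at h3
  exact h3

lemma LD.π_C (c : ℂ) : L.π (C c) = Polynomial.C c := by
  simp

lemma LD.π_hom (x : ℕ) (f : Polynomial ℂ) (hf : f ∈ Polynomial.degreeLT ℂ (x + 1)) :
    L.π (L.hom x f) = f := by
  simp only [LD.hom, map_sum, map_mul, map_pow, L.πs, L.πt, one_pow, one_mul, LD.π_C]
  have h := Polynomial.mem_degreeLT.1 hf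
  by_cases h0 : f = 0
  · simp [h0]
  rw [Polynomial.degree_eq_natDegree h0] at h
  norm_cast at h
  exact (Polynomial.as_sum_range_C_mul_X_pow' f h).symm

lemma Hm_zero {p : GS} (hp : p ∈ Hm 0) : ∃ c, p = C c := by
  have := (totalDegree_zero_iff_isHomogeneous (p := p)).2 hp
  exact ⟨_, totalDegree_eq_zero_iff_eq_C.1 this⟩

lemma LD.π_mem (x : ℕ) : ∀ p ∈ Hm x, L.π p ∈ Polynomial.degreeLT ℂ (x + 1) := by
  induction x with
  | zero =>
    intro p hp
    obtain ⟨c, rfl⟩ := Hm_zero hp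
    rw [L.π_C, Polynomial.mem_degreeLT]
    exact lt_of_le_of_lt Polynomial.degree_C_le (by norm_num)
  | succ x ih =>
    intro p hp
    refine Hm_induction (P := fun p => L.π p ∈ Polynomial.degreeLT ℂ (x + 1 + 1)) ?_ ?_ hp
    · intro p q hp hq
      rw [map_add]; exact add_mem hp hq
    · intro i q hq
      have h1 := ih q hq
      rw [map_mul, L.πX, add_mul, mul_assoc, ← Polynomial.smul_eq_C_mul,
        ← Polynomial.smul_eq_C_mul]
      refine add_mem (Submodule.smul_mem _ _ (Polynomial.degreeLT_mono (by omega) h1))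
        (Submodule.smul_mem _ _ ?_)
      exact gmX_le le_rfl (Submodule.mem_map_of_mem h1)

lemma LD.decomp_step (x : ℕ) (h : ∀ p ∈ Hm x, ∃ q : GS, p = L.hom x (L.π p) + l * q ∧
    ∀ m ∈ Hm 1, m * q ∈ Hm x) :
    ∀ p ∈ Hm (x + 1), ∃ q ∈ Hm x, p = L.hom (x + 1) (L.π p) + l * q := by
  intro p hp
  refine Hm_induction (P := fun p => ∃ q ∈ Hm x, p = L.hom (x + 1) (L.π p) + l * q) ?_ ?_ hp
  · rintro p p' ⟨q, h1, h2⟩ ⟨q', h1', h2'⟩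
    refine ⟨q + q', add_mem h1 h1', ?_⟩
    rw [map_add, L.hom_add]
    linear_combination h2 + h2'
  · intro i p hp
    obtain ⟨q, h1, h2⟩ := h p hp
    have hpm := L.π_mem x p hp
    have e1 : L.hom (x + 1) (L.π (X i * p)) =
        (C (L.b i) * L.s + C (L.e i) * L.t) * L.hom x (L.π p) := by
      rw [map_mul, L.πX, add_mul, mul_assoc, L.hom_add, L.hom_C, L.hom_C, L.hom_s _ _ hpm,
        L.hom_X]
      ring
    have h5 : C (L.b i) * L.s + C (L.e i) * L.t ∈ Hm 1 :=
      add_mem (MvPolynomial.IsHomogeneous.C_mul L.hs _)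
        (MvPolynomial.IsHomogeneous.C_mul L.ht _)
    refine ⟨(C (L.b i) * L.s + C (L.e i) * L.t) * q + C (L.g i) * p,
      add_mem (h2 _ h5) (MvPolynomial.IsHomogeneous.C_mul hp _), ?_⟩
    rw [e1]
    linear_combination p * L.hX i + (C (L.b i) * L.s + C (L.e i) * L.t) * h1

lemma LD.decomp (x : ℕ) : ∀ p ∈ Hm (x + 1), ∃ q ∈ Hm x, p = L.hom (x + 1) (L.π p) + l * q := by
  induction x with
  | zero =>
    apply L.decomp_step
    intro p hp
    obtain ⟨c, rfl⟩ := Hm_zero hp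
    exact ⟨0, by simp [LD.hom, L.π_C], fun m _ => by simp⟩
  | succ x ih =>
    apply L.decomp_step
    intro p hp
    obtain ⟨q, hq, h⟩ := ih p hp
    refine ⟨q, h, fun m hm => ?_⟩
    have := Hm_mul hm hq
    rwa [add_comm] at this

lemma LD.ker {x : ℕ} {p : GS} (hp : p ∈ Hm (x + 1)) (h : L.π p = 0) : ∃ q ∈ Hm x, p = l * q := by
  obtain ⟨q, hq, h1⟩ := L.decomp x p hp
  refine ⟨q, hq, ?_⟩
  rw [h] at h1
  simpa [LD.hom] using h1

lemma LD.surj (x : ℕ) {f : Polynomial ℂ} (hf : f ∈ Polynomial.degreeLT ℂ (x + 1)) :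
    ∃ p ∈ Hm x, L.π p = f := ⟨_, L.hom_mem x f, L.π_hom x f hf⟩

lemma eval_zero_lin {s : GS} (hs : s ∈ Hm 1) : eval (0 : Fin 3 → ℂ) s = 0 := by
  refine Hm_induction (x := 0) (P := fun s => eval (0 : Fin 3 → ℂ) s = 0) ?_ ?_ hs
  · intro p q hp hq
    rw [map_add, hp, hq, add_zero]
  · intro i q _
    simp

lemma LD.pt (t : ℂ) : ∃ z : Fin 3 → ℂ, z ≠ 0 ∧ ∀ p, eval z p = (L.π p).eval t := by
  have key : ∀ p, eval (fun i => (L.π (X i)).eval t) p = (L.π p).eval t := by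
    intro p
    induction p using MvPolynomial.induction_on with
    | C c => simp [L.π_C]
    | add p q hp hq => simp [hp, hq]
    | mul_X p i hp => simp [hp]
  refine ⟨_, ?_, key⟩
  intro h0
  have h1 := key L.s
  rw [h0, L.πs, Polynomial.eval_one] at h1
  exact one_ne_zero (h1.symm.trans (eval_zero_lin L.hs))

lemma LD.pt_inf : ∃ z : Fin 3 → ℂ, z ≠ 0 ∧ ∀ x, ∀ p ∈ Hm x, eval z p = (L.π p).coeff x := by
  have key : ∀ x, ∀ p ∈ Hm x, eval L.e p = (L.π p).coeff x := by
    intro x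
    induction x with
    | zero =>
      intro p hp
      obtain ⟨c, rfl⟩ := Hm_zero hp
      simp [L.π_C]
    | succ x ih =>
      intro p hp
      refine Hm_induction (P := fun p => eval L.e p = (L.π p).coeff (x + 1)) ?_ ?_ hp
      · intro p q hp hq
        simp [hp, hq]
      · intro i q hq
        have h0 : (L.π q).coeff (x + 1) = 0 :=
          Polynomial.coeff_eq_zero_of_degree_lt (Polynomial.mem_degreeLT.1 (L.π_mem x q hq))
        rw [map_mul, map_mul, L.πX, eval_X, ih q hq, add_mul, mul_assoc, Polynomial.coeff_add,
          Polynomial.coeff_C_mul, Polynomial.coeff_C_mul, Polynomial.coeff_X_mul, h0]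
        ring
  refine ⟨L.e, ?_, key⟩
  intro h0
  have h1 := key 1 L.t L.ht
  rw [h0, L.πt, Polynomial.coeff_X_one] at h1
  exact one_ne_zero (h1.symm.trans (eval_zero_lin L.ht))

end GreenData
section GreenMain

/-- the annihilator, in degree `x`, of a functional on forms of degree `D` -/
def An (φ : GS →ₗ[ℂ] ℂ) (D x : ℕ) : Submodule ℂ GS where
  carrier := {p | p ∈ Hm x ∧ ∀ y, x + y = D → ∀ q ∈ Hm y, φ (p * q) = 0}
  add_mem' := by
    rintro p p' ⟨h1, h2⟩ ⟨h1', h2'⟩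
    refine ⟨add_mem h1 h1', fun y hy q hq => ?_⟩
    rw [add_mul, map_add, h2 y hy q hq, h2' y hy q hq, add_zero]
  zero_mem' := ⟨zero_mem _, fun y hy q hq => by simp⟩
  smul_mem' := by
    rintro c p ⟨h1, h2⟩
    refine ⟨Submodule.smul_mem _ _ h1, fun y hy q hq => ?_⟩
    rw [smul_mul_assoc, map_smul, h2 y hy q hq, smul_zero]

variable {φ : GS →ₗ[ℂ] ℂ} {D a : ℕ}

lemma mem_An {x : ℕ} {p : GS} :
    p ∈ An φ D x ↔ p ∈ Hm x ∧ ∀ y, x + y = D → ∀ q ∈ Hm y, φ (p * q) = 0 := Iff.rfl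

lemma An_le (x : ℕ) : An φ D x ≤ Hm x := fun _ h => h.1

instance An_fd (x : ℕ) : FiniteDimensional ℂ (An φ D x) :=
  Submodule.finiteDimensional_of_le (An_le x)

lemma An_mul {x : ℕ} {p m : GS} (hp : p ∈ An φ D x) (hm : m ∈ Hm 1) : m * p ∈ An φ D (x + 1) := by
  refine ⟨by rw [mul_comm]; exact Hm_mul hp.1 hm, fun y hy q hq => ?_⟩
  have := hp.2 (1 + y) (by omega) (m * q) (Hm_mul hm hq)
  rwa [show m * p * q = p * (m * q) by ring]

/-- restriction of the annihilator to the line -/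
noncomputable def LD.J {l : GS} (L : LD l) (φ : GS →ₗ[ℂ] ℂ) (D x : ℕ) : Submodule ℂ (Polynomial ℂ) :=
  (An φ D x).map L.π.toLinearMap

lemma LD.mem_J {l : GS} (L : LD l) {x : ℕ} {p : GS} (hp : p ∈ An φ D x) : L.π p ∈ L.J φ D x :=
  ⟨p, hp, rfl⟩

lemma LD.lineFam {l : GS} (L : LD l) {W : Submodule ℂ GS} (hW : W ≤ An φ D a)
    (hb : ∀ p : Fin 3 → ℂ, p ≠ 0 → ∃ w ∈ W, eval p w ≠ 0) : LineFam a (L.J φ D) where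
  le := by
    rintro x _ ⟨p, hp, rfl⟩
    exact L.π_mem x p hp.1
  one := by
    rintro x _ ⟨p, hp, rfl⟩
    have := L.mem_J (An_mul hp L.hs)
    rwa [map_mul, L.πs, one_mul] at this
  mulX := by
    rintro x _ ⟨p, hp, rfl⟩
    have := L.mem_J (An_mul hp L.ht)
    rwa [map_mul, L.πt] at this
  bpf := by
    intro t
    obtain ⟨z, hz, h⟩ := L.pt t
    obtain ⟨w, hw, hw'⟩ := hb z hz
    exact ⟨_, L.mem_J (hW hw), by rwa [← h]⟩
  inf := by
    obtain ⟨z, hz, h⟩ := L.pt_inf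
    obtain ⟨w, hw, hw'⟩ := hb z hz
    exact ⟨_, L.mem_J (hW hw), by rwa [← h a w (hW hw).1]⟩

lemma LD.rk {l : GS} (L : LD l) {x : ℕ} {B : Submodule ℂ GS} (hB : B ≤ Hm (x + 1)) :
    finrank ℂ B = finrank ℂ (B.map L.π.toLinearMap) +
      finrank ℂ (Hm x ⊓ B.comap (LinearMap.mulLeft ℂ l) : Submodule ℂ GS) := by
  have fB : FiniteDimensional ℂ B := Submodule.finiteDimensional_of_le hB
  have h1 := LinearMap.finrank_range_add_finrank_ker (L.π.toLinearMap.domRestrict B)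
  rw [LinearMap.range_domRestrict] at h1
  have hinj : Function.Injective (LinearMap.mulLeft ℂ l) := fun p q h => mul_left_cancel₀ L.l0 h
  have h2 := (Submodule.equivMapOfInjective (LinearMap.mulLeft ℂ l) hinj
    (Hm x ⊓ B.comap (LinearMap.mulLeft ℂ l))).finrank_eq
  have h3 : (LinearMap.ker (L.π.toLinearMap.domRestrict B)).map B.subtype =
      (Hm x ⊓ B.comap (LinearMap.mulLeft ℂ l)).map (LinearMap.mulLeft ℂ l) := by
    ext p
    constructor
    · rintro ⟨⟨p, hp⟩, hk, rfl⟩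
      obtain ⟨q, hq, rfl⟩ := L.ker (hB hp) (by simpa using hk)
      exact ⟨q, ⟨hq, hp⟩, rfl⟩
    · rintro ⟨q, ⟨hq, hp⟩, rfl⟩
      refine ⟨⟨_, hp⟩, ?_, rfl⟩
      simp [L.πl]
  have h4 := Submodule.finrank_map_subtype_eq B (LinearMap.ker (L.π.toLinearMap.domRestrict B))
  rw [h3] at h4
  omega

lemma LD.rk_Hm {l : GS} (L : LD l) (x : ℕ) : finrank ℂ (Hm (x + 1)) = x + 2 + finrank ℂ (Hm x) := by
  rw [L.rk le_rfl]
  congr 1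
  · have : (Hm (x + 1)).map L.π.toLinearMap = Polynomial.degreeLT ℂ (x + 2) := by
      apply le_antisymm
      · rintro _ ⟨p, hp, rfl⟩
        exact L.π_mem (x + 1) p hp
      · intro f hf
        obtain ⟨p, hp, rfl⟩ := L.surj (x + 1) hf
        exact ⟨p, hp, rfl⟩
    rw [this, finrank_degLT]
  · have : Hm x ⊓ (Hm (x + 1)).comap (LinearMap.mulLeft ℂ l) = Hm x := by
      rw [inf_eq_left]
      intro p hp
      have := Hm_mul L.hl hp
      rw [add_comm] at this
      exact this
    rw [this]

/-- multiplication by `l` is injective in degree `x` modulo the annihilator -/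
def GInj (φ : GS →ₗ[ℂ] ℂ) (D : ℕ) (l : GS) (x : ℕ) : Prop :=
  ∀ p ∈ Hm x, l * p ∈ An φ D (x + 1) → p ∈ An φ D x

/-- Hilbert function -/
noncomputable def HH (φ : GS →ₗ[ℂ] ℂ) (D x : ℕ) : ℕ := finrank ℂ (Hm x) - finrank ℂ (An φ D x)

lemma HH_add (x : ℕ) : HH φ D x + finrank ℂ (An φ D x) = finrank ℂ (Hm x) :=
  Nat.sub_add_cancel (Submodule.finrank_mono (An_le x))

lemma LD.step {l : GS} (L : LD l) {x : ℕ} (h : GInj φ D l x) :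
    HH φ D (x + 1) + finrank ℂ (L.J φ D (x + 1)) = HH φ D x + (x + 2) := by
  have h1 := L.rk (An_le (φ := φ) (D := D) (x + 1))
  have h2 : Hm x ⊓ (An φ D (x + 1)).comap (LinearMap.mulLeft ℂ l) = An φ D x := by
    apply le_antisymm
    · rintro p ⟨hp, hp'⟩
      exact h p hp hp'
    · intro p hp
      exact ⟨hp.1, An_mul hp L.hl⟩
  rw [h2] at h1
  have h3 := L.rk_Hm x
  have h4 := HH_add (φ := φ) (D := D) x
  have h5 := HH_add (φ := φ) (D := D) (x + 1)
  have h6 : finrank ℂ (L.J φ D (x + 1)) =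
    finrank ℂ ((An φ D (x + 1)).map L.π.toLinearMap) := rfl
  omega

lemma LD.HH_ge {l : GS} (L : LD l) (x : ℕ) :
    x + 2 ≤ HH φ D (x + 1) + finrank ℂ (L.J φ D (x + 1)) := by
  have h1 := L.rk (An_le (φ := φ) (D := D) (x + 1))
  have h2 : finrank ℂ (Hm x ⊓ (An φ D (x + 1)).comap (LinearMap.mulLeft ℂ l) : Submodule ℂ GS) ≤
    finrank ℂ (Hm x) := Submodule.finrank_mono inf_le_left
  have h3 := L.rk_Hm x
  have h5 := HH_add (φ := φ) (D := D) (x + 1)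
  have h6 : finrank ℂ (L.J φ D (x + 1)) =
    finrank ℂ ((An φ D (x + 1)).map L.π.toLinearMap) := rfl
  omega

lemma HH_pos {x : ℕ} (hφ : ∃ p ∈ Hm D, φ p ≠ 0) (hx : x ≤ D) : 1 ≤ HH φ D x := by
  by_contra h0
  have h1 := HH_add (φ := φ) (D := D) x
  have h2 : An φ D x = Hm x := Submodule.eq_of_le_of_finrank_eq (An_le x) (by omega)
  obtain ⟨p, hp, hp'⟩ := hφ
  apply hp'
  obtain ⟨y, rfl⟩ := Nat.exists_eq_add_of_le hx
  rw [Hm_add] at hp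
  refine Submodule.mul_induction_on hp ?_ ?_
  · intro m hm n hn
    rw [← h2] at hm
    exact hm.2 y rfl n hn
  · intro p q hp hq
    rw [map_add, hp, hq, add_zero]

lemma GInj.down {l : GS} {x : ℕ} (h : GInj φ D l a) (hx : x ≤ a) (ha : a ≤ D) : GInj φ D l x := by
  intro p hp hlp
  refine ⟨hp, fun y hy q hq => ?_⟩
  obtain ⟨k, rfl⟩ := Nat.exists_eq_add_of_le hx
  obtain ⟨r, hr⟩ := Nat.exists_eq_add_of_le ha
  have hyk : y = k + r := by omega
  subst hyk
  rw [Hm_add] at hq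
  refine Submodule.mul_induction_on hq ?_ ?_
  · intro m hm n hn
    have h1 : p * m ∈ An φ D (x + k) := by
      refine h _ (Hm_mul hp hm) ⟨?_, fun z hz u hu => ?_⟩
      · have := Hm_mul hlp.1 hm
        rw [show x + k + 1 = x + 1 + k by omega, ← mul_assoc]
        exact this
      · have := hlp.2 (k + z) (by omega) (m * u) (Hm_mul hm hu)
        rwa [show l * (p * m) * u = l * p * (m * u) by ring]
    have := h1.2 r (by omega) n hn
    rwa [← mul_assoc]
  · intro p' q' h1 h2
    rw [mul_add, map_add, h1, h2, add_zero]

lemma LD.full {l : GS} (L : LD l) (hf : ∀ x, L.J φ D x ≤ Polynomial.degreeLT ℂ (x + 1)) {j : ℕ}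
    (hj : finrank ℂ (L.J φ D (j + 1)) = j + 2) {q : GS} (hq : q ∈ Hm (j + 1)) :
    ∃ r ∈ An φ D (j + 1), ∃ q' ∈ Hm j, q = r + l * q' := by
  have h1 : L.J φ D (j + 1) = Polynomial.degreeLT ℂ (j + 2) :=
    Submodule.eq_of_le_of_finrank_eq (hf (j + 1)) (by rw [hj, finrank_degLT])
  have h2 := L.π_mem (j + 1) q hq
  rw [← h1] at h2
  obtain ⟨r, hr, hr'⟩ := h2
  have hr'' : L.π r = L.π q := hr'
  obtain ⟨q', hq', h3⟩ := L.ker (sub_mem hq (An_le _ hr)) (by rw [map_sub, hr'', sub_self])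
  exact ⟨r, hr, q', hq', by rw [← h3]; ring⟩

lemma LD.inj_of_full {l : GS} (L : LD l) (hf : ∀ x, L.J φ D x ≤ Polynomial.degreeLT ℂ (x + 1))
    {j x : ℕ} (hj : finrank ℂ (L.J φ D (j + 1)) = j + 2) (hx : x + (j + 1) = D) :
    GInj φ D l x := by
  intro p hp hlp
  refine ⟨hp, fun y hy q hq => ?_⟩
  have : y = j + 1 := by omega
  subst this
  obtain ⟨r, hr, q', hq', rfl⟩ := L.full hf hj hq
  have h1 := hr.2 x (by omega) p hp
  have h2 := hlp.2 j (by omega) q' hq'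
  rw [mul_add, map_add, mul_comm p r, h1, show p * (l * q') = l * p * q' by ring, h2, add_zero]

lemma pencil_aux {V V' : Type*} [AddCommGroup V] [Module ℂ V] [AddCommGroup V'] [Module ℂ V']
    [FiniteDimensional ℂ V] [FiniteDimensional ℂ V'] [Nontrivial V]
    (hd : finrank ℂ V = finrank ℂ V') (f g : V →ₗ[ℂ] V') (hf : Function.Injective f) :
    ∃ μ : ℂ, ∃ v : V, v ≠ 0 ∧ g v = μ • f v := by
  let e := LinearEquiv.ofInjectiveOfFinrankEq f hf hd
  have he : ∀ v, e v = f v := fun v => rfl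
  obtain ⟨μ, hμ⟩ := Module.End.exists_eigenvalue (e.symm.toLinearMap ∘ₗ g)
  obtain ⟨v, hv⟩ := hμ.exists_hasEigenvector
  refine ⟨μ, v, hv.2, ?_⟩
  have h1 := hv.apply_eq_smul
  have h2 := congrArg e h1
  rw [LinearMap.comp_apply, map_smul, he v] at h2
  rw [← h2]
  exact (e.apply_symm_apply (g v)).symm

/-- multiplication by a linear form on homogeneous polynomials -/
noncomputable def mulR (x : ℕ) (l : GS) (hl : l ∈ Hm 1) : Hm x →ₗ[ℂ] Hm (x + 1) where
  toFun p := ⟨l * p.1, by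
      have := Hm_mul hl p.2
      rw [add_comm] at this
      exact this⟩
  map_add' p q := by
    ext1
    simp [mul_add]
  map_smul' c p := by
    ext1
    simp

/-- multiplication by a linear form on the quotients -/
noncomputable def mulQ (φ : GS →ₗ[ℂ] ℂ) (D x : ℕ) (l : GS) (hl : l ∈ Hm 1) :
    (Hm x ⧸ (An φ D x).comap (Hm x).subtype) →ₗ[ℂ]
      (Hm (x + 1) ⧸ (An φ D (x + 1)).comap (Hm (x + 1)).subtype) :=
  Submodule.mapQ _ _ (mulR x l hl) (fun _ hp => An_mul (φ := φ) (D := D) hp hl)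

lemma mulQ_mk (x : ℕ) (l : GS) (hl : l ∈ Hm 1) (p : Hm x) :
    mulQ φ D x l hl (Submodule.Quotient.mk p) = Submodule.Quotient.mk (mulR x l hl p) := rfl

lemma finrank_Q (x : ℕ) : finrank ℂ (Hm x ⧸ (An φ D x).comap (Hm x).subtype) = HH φ D x := by
  have h1 := Submodule.finrank_quotient_add_finrank ((An φ D x).comap (Hm x).subtype)
  have h2 := (Submodule.comapSubtypeEquivOfLe (An_le (φ := φ) (D := D) x)).finrank_eq
  have h3 := HH_add (φ := φ) (D := D) x
  omega

lemma no_pencil {x : ℕ} (hφ : ∃ p ∈ Hm D, φ p ≠ 0) (hx : x ≤ D)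
    (hinj : ∀ v : Fin 3 → ℂ, v ≠ 0 → GInj φ D (linf v) x) : HH φ D (x + 1) ≠ HH φ D x := by
  intro he
  have hpos := HH_pos hφ hx
  have hnt : Nontrivial (Hm x ⧸ (An φ D x).comap (Hm x).subtype) :=
    Module.nontrivial_of_finrank_pos (R := ℂ) (by rw [finrank_Q]; omega)
  let v0 : Fin 3 → ℂ := ![1, 0, 0]
  let v1 : Fin 3 → ℂ := ![0, 1, 0]
  have hv0 : v0 ≠ 0 := fun h => by simpa [v0] using congrFun h 0
  have hf : Function.Injective (mulQ φ D x (linf v0) (linf_mem v0)) := by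
    rw [injective_iff_map_eq_zero]
    intro q
    obtain ⟨p, rfl⟩ := Submodule.Quotient.mk_surjective _ q
    intro h
    rw [mulQ_mk, Submodule.Quotient.mk_eq_zero] at h
    rw [Submodule.Quotient.mk_eq_zero]
    exact hinj v0 hv0 p.1 p.2 h
  obtain ⟨μ, q, hq, h⟩ := pencil_aux (by rw [finrank_Q, finrank_Q, he])
    (mulQ φ D x (linf v0) (linf_mem v0)) (mulQ φ D x (linf v1) (linf_mem v1)) hf
  obtain ⟨p, rfl⟩ := Submodule.Quotient.mk_surjective _ q
  apply hq
  rw [mulQ_mk, mulQ_mk, ← Submodule.Quotient.mk_smul,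
    Submodule.Quotient.eq] at h
  rw [Submodule.Quotient.mk_eq_zero]
  have hv : (![-μ, 1, 0] : Fin 3 → ℂ) ≠ 0 := fun h => by simpa using congrFun h 1
  refine hinj _ hv p.1 p.2 ?_
  have h' : linf v1 * p.1 - μ • (linf v0 * p.1) ∈ An φ D (x + 1) := h
  convert h' using 1
  simp [linf, v0, v1, MvPolynomial.smul_eq_C_mul]
  ring

lemma LD.not_full {v : Fin 3 → ℂ} (hv : v ≠ 0) (L : LD (linf v)) {x : ℕ}
    (hφ : ∃ p ∈ Hm D, φ p ≠ 0) (hx : x ≤ D)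
    (hinj : ∀ v : Fin 3 → ℂ, v ≠ 0 → GInj φ D (linf v) x) :
    finrank ℂ (L.J φ D (x + 1)) ≠ x + 2 := by
  intro h
  have h1 := L.step (hinj v hv)
  exact no_pencil hφ hx hinj (by omega)

end GreenMain
lemma green_core (a c : ℕ) : ∀ (φ : GS →ₗ[ℂ] ℂ) (W : Submodule ℂ GS),
    (∀ p : Fin 3 → ℂ, p ≠ 0 → ∃ w ∈ W, eval p w ≠ 0) → W ≤ An φ (a + c) a →
    (∃ p ∈ Hm (a + c), φ p ≠ 0) → c + 1 ≤ HH φ (a + c) a := by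
  induction c with
  | zero =>
    intro φ W hb hW hφ
    have := HH_pos hφ (show a ≤ a + 0 by omega)
    omega
  | succ c ih =>
    intro φ W hb hW hφ
    by_contra hcon
    have hcon : HH φ (a + (c + 1)) a ≤ c + 1 := by omega
    -- Step 1: injectivity in degree `a` for every line
    have inj_a : ∀ v : Fin 3 → ℂ, v ≠ 0 → GInj φ (a + (c + 1)) (linf v) a := by
      intro v hv
      obtain ⟨L⟩ := exists_LD v hv
      have F := L.lineFam hW hb
      by_cases hl : ∃ p ∈ Hm (a + c), φ (linf v * p) ≠ 0
      · let φ' : GS →ₗ[ℂ] ℂ := φ ∘ₗ LinearMap.mulLeft ℂ (linf v)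
        have hφ' : ∀ p, φ' p = φ (linf v * p) := fun p => rfl
        have hsub : An φ (a + (c + 1)) a ≤ An φ' (a + c) a := by
          intro p hp
          refine ⟨hp.1, fun y hy q hq => ?_⟩
          have := hp.2 (1 + y) (by omega) (linf v * q) (Hm_mul (linf_mem v) hq)
          rw [hφ', show linf v * (p * q) = p * (linf v * q) by ring]
          exact this
        have h1 := ih φ' W hb (hW.trans hsub) hl
        have h2 := HH_add (φ := φ) (D := a + (c + 1)) a
        have h3 := HH_add (φ := φ') (D := a + c) a
        have h4 : An φ (a + (c + 1)) a = An φ' (a + c) a :=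
          Submodule.eq_of_le_of_finrank_le hsub (by omega)
        intro p hp hlp
        rw [h4]
        refine ⟨hp, fun y hy q hq => ?_⟩
        have := hlp.2 y (by omega) q hq
        rw [hφ', ← mul_assoc]
        exact this
      · exfalso
        push Not at hl
        have hD : finrank ℂ (L.J φ (a + (c + 1)) (a + (c + 1))) ≠ a + (c + 1) + 1 := by
          intro hfull
          obtain ⟨p, hp, hp'⟩ := hφ
          obtain ⟨r, hr, q', hq', rfl⟩ := L.full F.le (j := a + c) hfull hp
          apply hp'
          rw [map_add, hl q' hq', add_zero]
          have := hr.2 0 (by omega) 1 (isHomogeneous_one _ _)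
          rwa [mul_one] at this
        have h1 := F.strict (c + 1)
        have h2 := F.bound (a + (c + 1))
        have h3 := F.pos
        obtain ⟨a', rfl⟩ : ∃ a', a = a' + 1 := ⟨a - 1, by omega⟩
        have h4 := L.HH_ge (φ := φ) (D := a' + 1 + (c + 1)) a'
        omega
    -- Step 2
    have hv0 : (![1, 0, 0] : Fin 3 → ℂ) ≠ 0 := fun h => by simpa using congrFun h 0
    obtain ⟨L⟩ := exists_LD _ hv0
    have F := L.lineFam hW hb
    have inj_x : ∀ x, x ≤ a → GInj φ (a + (c + 1)) (linf ![1, 0, 0]) x :=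
      fun x hx => (inj_a _ hv0).down hx (by omega)
    have hstep : ∀ x, x ≤ a → _ := fun x hx => L.step (inj_x x hx)
    have h0 := HH_pos hφ (show 0 ≤ a + (c + 1) by omega)
    have hpos := F.pos
    have hnf := L.not_full hv0 hφ (show a ≤ a + (c + 1) by omega) inj_a
    have hs1 := F.strict 1
    have hb1 := F.bound (a + 1)
    have hja : finrank ℂ (L.J φ (a + (c + 1)) a) + 1 ≤ a := by omega
    have hmono : ∀ x, x ≤ a → 1 ≤ finrank ℂ (L.J φ (a + (c + 1)) x) →
        finrank ℂ (L.J φ (a + (c + 1)) x) + (a - x) ≤ finrank ℂ (L.J φ (a + (c + 1)) a) :=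
      fun x hx h => F.mono hx h
    by_cases hc : c + 1 ≤ 2 * a
    · have hH : ∀ x, x ≤ a → 2 * x + 1 ≤ HH φ (a + (c + 1)) x := by
        intro x
        induction x with
        | zero => intro _; omega
        | succ x ihx =>
          intro hx
          have h1 := ihx (by omega)
          have h2 := hstep x (by omega)
          have h3 := hmono (x + 1) hx
          omega
      have := hH a le_rfl
      omega
    · have hfull : ∀ v : Fin 3 → ℂ, v ≠ 0 → ∀ L' : LD (linf v), ∀ y, 2 * a ≤ y →
          finrank ℂ (L'.J φ (a + (c + 1)) y) = y + 1 := by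
        intro v hv L' y hy
        have F' := L'.lineFam hW hb
        have h1 := F'.strict a
        have h2 := F'.pos
        have h3 := F'.bound (a + a)
        have h4 := F'.mono (show a + a ≤ y by omega)
        have h5 := F'.bound y
        omega
      have hinj : ∀ v : Fin 3 → ℂ, v ≠ 0 → GInj φ (a + (c + 1)) (linf v) (c + 1 - a) := by
        intro v hv
        obtain ⟨L'⟩ := exists_LD v hv
        have F' := L'.lineFam hW hb
        refine L'.inj_of_full F'.le (j := 2 * a - 1) ?_ (by omega)
        rw [hfull v hv L' _ (by omega)]
      have hnf2 := L.not_full hv0 hφ (show c + 1 - a ≤ a + (c + 1) by omega) hinj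
      have hc3 : c + 1 - a + 1 < 2 * a := by
        by_contra h
        exact hnf2 (hfull _ hv0 L _ (by omega))
      have hs2 := F.strict 2
      have hm2 := F.mono (show a + 2 ≤ c + 1 - a + 1 by omega)
      have hb2 := F.bound (c + 1 - a + 1)
      have hb3 := F.bound (a + 2)
      have hja2 : finrank ℂ (L.J φ (a + (c + 1)) a) + 2 ≤ a := by omega
      have hH : ∀ x, x ≤ a → 3 * x ≤ HH φ (a + (c + 1)) x := by
        intro x
        induction x with
        | zero => intro _; omega
        | succ x ihx =>
          intro hx
          have h1 := ihx (by omega)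
          have h2 := hstep x (by omega)
          have h3 := hmono (x + 1) hx
          rcases x with _ | x <;> omega
      have := hH a le_rfl
      omega

/-- Green's theorem on multiplication maps (in `ℙ²`): if `W ⊆ S^a` is a base-point-free
linear subspace of codimension `c` and `m ≥ c`, then the multiplication map
`W ⊗ S^m → S^{m+a}` is surjective. -/
theorem green_multiplication (a m c : ℕ) (W : Submodule ℂ (MvPolynomial (Fin 3) ℂ))
    (hW : W ≤ homogeneousSubmodule (Fin 3) ℂ a)
    (hcodim : finrank ℂ W + c = finrank ℂ (homogeneousSubmodule (Fin 3) ℂ a))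
    (hbpf : ∀ p : Fin 3 → ℂ, p ≠ 0 → ∃ w ∈ W, eval p w ≠ 0)
    (hm : c ≤ m) :
    ∀ p ∈ homogeneousSubmodule (Fin 3) ℂ (m + a),
      p ∈ Submodule.span ℂ
        {q : MvPolynomial (Fin 3) ℂ | ∃ w ∈ W,
          ∃ s ∈ homogeneousSubmodule (Fin 3) ℂ m, q = w * s} := by
  intro p hp
  by_contra hnot
  obtain ⟨φ, hφp, hφ⟩ := Submodule.exists_le_ker_of_notMem hnot
  have hWA : W ≤ An φ (a + m) a := by
    intro w hw
    refine ⟨hW hw, fun y hy q hq => ?_⟩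
    have : y = m := by omega
    subst this
    exact hφ (Submodule.subset_span ⟨w, hw, q, hq, rfl⟩)
  have h1 := green_core a m φ W hbpf hWA ⟨p, by rw [add_comm]; exact hp, hφp⟩
  have h2 := HH_add (φ := φ) (D := a + m) a
  have h3 : finrank ℂ W ≤ finrank ℂ (An φ (a + m) a) := Submodule.finrank_mono hWA
  have h4 : finrank ℂ W + c = finrank ℂ (Hm a) := hcodim
  omega
end

section
/- Let S = ℂ[x,y,z] and W ⊆ S^a a linear subspace of codimension c < a. Then for a general line H ⊂ ℙ² (equivalently, for a generic linear form h), the restriction map W → H⁰(H, O_H(a)) ≅ ℂ[s,t]_a given by restricting polynomials to H is surjective. -/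
open MvPolynomial Module

theorem dichotomy {A m n : Type*} [CommRing A] [IsDomain A] [Fintype m] [Fintype n] [DecidableEq n] [DecidableEq m]
    (M : Matrix m n A) :
    (∃ l : n → A, l ≠ 0 ∧ M.mulVec l = 0) ∨
    (∃ g : A, g ≠ 0 ∧ ∃ N : Matrix n m A, N * M = g • (1 : Matrix n n A)) := by
  classical
  let K := FractionRing A
  have hinj : Function.Injective (algebraMap A K) := IsFractionRing.injective A K
  let MK : Matrix m n K := M.map (algebraMap A K)
  by_cases h : LinearMap.ker (Matrix.toLin' MK) = ⊥
  · right
    obtain ⟨f, hf⟩ := LinearMap.exists_leftInverse_of_injective _ h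
    let NK := LinearMap.toMatrix' f
    have hNK : NK * MK = 1 := by
      have := congrArg LinearMap.toMatrix' hf
      rw [LinearMap.toMatrix'_comp] at this
      simpa using this
    obtain ⟨b, hb⟩ := IsLocalization.exist_integer_multiples_of_finite (nonZeroDivisors A)
      (fun ij : n × m => NK ij.1 ij.2)
    choose N hN using hb
    refine ⟨b, nonZeroDivisors.coe_ne_zero b, Matrix.of fun i j => N (i, j), ?_⟩
    ext i j
    apply hinj
    have h1 := congrFun (congrFun hNK i) j
    rw [Matrix.mul_apply] at h1 ⊢
    rw [map_sum]
    simp only [Matrix.of_apply, map_mul, hN]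
    have h2 : ∀ x, algebraMap A K (M x j) = MK x j := fun x => rfl
    simp only [h2, Algebra.smul_def, mul_assoc, ← Finset.mul_sum, h1, Matrix.smul_apply,
      smul_eq_mul, map_mul]
    congr 1
    simp [Matrix.one_apply, apply_ite (algebraMap A K)]
  · left
    obtain ⟨l, hl, hl0⟩ := Submodule.exists_mem_ne_zero_of_ne_bot h
    obtain ⟨b, hb⟩ := IsLocalization.exist_integer_multiples_of_finite (nonZeroDivisors A) l
    choose k hk using hb
    have hb0 : algebraMap A K b ≠ 0 := by
      simp
    refine ⟨k, ?_, ?_⟩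
    · rintro rfl
      apply hl0
      ext i
      have := hk i
      simp only [Pi.zero_apply, map_zero, Algebra.smul_def] at this
      exact (mul_eq_zero.1 this.symm).resolve_left hb0
    · ext i
      apply hinj
      have h1 := congrFun (LinearMap.mem_ker.1 hl) i
      rw [Matrix.toLin'_apply] at h1
      simp only [Matrix.mulVec, dotProduct] at h1 ⊢
      rw [map_sum]
      simp only [map_mul, hk]
      have h2 : ∀ x, algebraMap A K (M i x) = MK i x := fun x => rfl
      simp only [h2, Algebra.smul_def, mul_left_comm _ (algebraMap A K b), ← Finset.mul_sum, h1]
      simp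

theorem powers_span (a : ℕ) (φ : MvPolynomial (Fin 3) ℂ →ₗ[ℂ] ℂ)
    (h : ∀ y : Fin 3 → ℂ, φ ((∑ i, C (y i) * X i) ^ a) = 0) :
    ∀ p ∈ homogeneousSubmodule (Fin 3) ℂ a, φ p = 0 := by
  classical
  have expand : ∀ y : Fin 3 → ℂ, φ ((∑ i, C (y i) * X i) ^ a) =
      ∑ k ∈ Finset.piAntidiag Finset.univ a, (Nat.multinomial Finset.univ k : ℂ) *
        (∏ i, y i ^ k i) * φ (monomial (Finsupp.equivFunOnFinite.symm k) 1) := by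
    intro y
    rw [Finset.sum_pow_eq_sum_piAntidiag, map_sum]
    refine Finset.sum_congr rfl fun k _ => ?_
    have : (Nat.multinomial Finset.univ k : MvPolynomial (Fin 3) ℂ) *
        ∏ i, (C (y i) * X i) ^ k i = ((Nat.multinomial Finset.univ k : ℂ) *
        (∏ i, y i ^ k i)) • monomial (Finsupp.equivFunOnFinite.symm k) (1 : ℂ) := by
      simp only [mul_pow, Finset.prod_mul_distrib, smul_eq_C_mul, map_mul, map_prod, map_pow,
        map_natCast, mul_assoc]
      congr 2
      rw [monomial_eq, Finsupp.prod_fintype _ _ (by simp)]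
      simp
    rw [this, map_smul, smul_eq_mul]
  let P : MvPolynomial (Fin 3) ℂ := ∑ k ∈ Finset.piAntidiag Finset.univ a,
    monomial (Finsupp.equivFunOnFinite.symm k) ((Nat.multinomial Finset.univ k : ℂ) *
      φ (monomial (Finsupp.equivFunOnFinite.symm k) 1))
  have hP : P = 0 := by
    apply MvPolynomial.funext
    intro y
    rw [map_zero, ← h y, expand, map_sum]
    refine Finset.sum_congr rfl fun k _ => ?_
    rw [eval_monomial, Finsupp.prod_fintype _ _ (by simp)]
    simp only [Finsupp.equivFunOnFinite_symm_apply_apply]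
    ring
  have hmon : ∀ d : Fin 3 →₀ ℕ, d.degree = a → φ (monomial d 1) = 0 := by
    intro d hd
    have hc := congrArg (coeff d) hP
    simp only [P, coeff_sum, coeff_monomial, coeff_zero] at hc
    rw [Finset.sum_eq_single (d : Fin 3 → ℕ)] at hc
    · simp only [Finsupp.equivFunOnFinite_symm_coe, if_true] at hc
      refine (mul_eq_zero.1 hc).resolve_left ?_
      exact_mod_cast (Nat.multinomial_pos _ _).ne'
    · intro b _ hb
      rw [if_neg]
      rintro rfl
      exact hb (by simp)
    · intro hn
      exfalso
      apply hn
      simp only [Finset.mem_piAntidiag]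
      refine ⟨?_, by simp⟩
      rw [← hd, Finsupp.degree_eq_sum]
  intro p hp
  rw [p.as_sum, map_sum]
  refine Finset.sum_eq_zero fun d hd => ?_
  have : monomial d (coeff d p) = coeff d p • monomial d (1 : ℂ) := by simp [smul_monomial]
  rw [this, map_smul, hmon d, smul_zero]
  rw [Finsupp.degree_eq_weight_one]
  exact hp (mem_support_iff.1 hd)

theorem triangular (a c : ℕ) (hca : c < a) (u : ℕ → Fin c → ℂ)
    (L : MvPolynomial (Fin 3) ℂ →ₗ[ℂ] (Fin c → ℂ)) (z y : MvPolynomial (Fin 3) ℂ)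
    (hz : z ∈ homogeneousSubmodule (Fin 3) ℂ 1) (hy : y ∈ homogeneousSubmodule (Fin 3) ℂ 1)
    (h : ∀ k, ∀ m ∈ homogeneousSubmodule (Fin 3) ℂ (a-1),
      u k ⬝ᵥ L (z * m) = - (k : ℂ) * (u (k-1) ⬝ᵥ L (y * m)))
    (h0 : u 0 ⬝ᵥ L (y ^ a) ≠ 0) : False := by
  have key : ∀ k j, j ≤ a → (u k ⬝ᵥ L (z ^ j * y ^ (a - j))) = 
      (-1) ^ j * (k.descFactorial j) * (u (k - j) ⬝ᵥ L (y ^ a)) := by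
    intro k j
    induction j generalizing k with
    | zero => intro _; simp
    | succ j ih => 
      intro hj
      have e1 : z ^ (j+1) * y ^ (a - (j+1)) = z * (z ^ j * y ^ (a - (j + 1))) := by ring
      have e2 : y * (z ^ j * y ^ (a - (j + 1))) = z ^ j * y ^ (a - j) := by
        have : a - j = a - (j+1) + 1 := by omega
        rw [this]; ring
      have hm : z ^ j * y ^ (a - (j + 1)) ∈ homogeneousSubmodule (Fin 3) ℂ (a-1) := by
        have := ((mem_homogeneousSubmodule _ _).1 hz |>.pow j).mul
          ((mem_homogeneousSubmodule _ _).1 hy |>.pow (a - (j+1)))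
        rw [mem_homogeneousSubmodule]
        convert this using 1
        omega
      rw [e1, h k _ hm, e2, ih (k-1) (by omega)]
      rcases k with _ | k
      · simp
      · rw [Nat.succ_descFactorial_succ, show k + 1 - 1 - j = k + 1 - (j + 1) by omega]
        push_cast
        ring
  let U : Matrix (Fin (a+1)) (Fin c) ℂ := fun k => u k
  let R : Matrix (Fin c) (Fin (a+1)) ℂ := fun i j => L (z ^ (j:ℕ) * y ^ (a - (j:ℕ))) i
  have hUR : ∀ k j, (U * R) k j = u k ⬝ᵥ L (z ^ (j:ℕ) * y ^ (a - (j:ℕ))) := fun k j => rfl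
  have hdet : (U * R).det ≠ 0 := by
    rw [Matrix.det_of_isLowerTriangular]
    · rw [Finset.prod_ne_zero_iff]
      intro k _
      rw [hUR, key _ _ (by omega)]
      simp only [Nat.sub_self, Nat.descFactorial_self]
      refine mul_ne_zero (mul_ne_zero (by simp) ?_) h0
      exact_mod_cast Nat.factorial_ne_zero _
    · intro i j hij
      rw [hUR, key _ _ (by omega)]
      have : (i:ℕ) < j := by simpa using hij
      rw [Nat.descFactorial_eq_zero_iff_lt.2 this]
      simp
  have hr := Matrix.rank_of_isUnit (U * R) ((Matrix.isUnit_iff_isUnit_det _).2 (isUnit_iff_ne_zero.2 hdet))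
  have := (Matrix.rank_mul_le_left U R).trans (Matrix.rank_le_card_width U)
  simp at hr this
  omega

theorem exists_functionals (a c : ℕ)
    (W : Submodule ℂ (MvPolynomial (Fin 3) ℂ))
    (hW : W ≤ homogeneousSubmodule (Fin 3) ℂ a)
    (hcodim : finrank ℂ W + c = finrank ℂ (homogeneousSubmodule (Fin 3) ℂ a)) :
    ∃ L : MvPolynomial (Fin 3) ℂ →ₗ[ℂ] (Fin c → ℂ),
      (∀ p ∈ homogeneousSubmodule (Fin 3) ℂ a, L p = 0 → p ∈ W) ∧
      (∀ u, ∃ p ∈ homogeneousSubmodule (Fin 3) ℂ a, L p = u) := by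
  have : Module.Finite ℂ (homogeneousSubmodule (Fin 3) ℂ a) :=
    Module.Finite.iff_fg.2 (homogeneousSubmodule_fg _ _ a)
  let W' := W.comap (homogeneousSubmodule (Fin 3) ℂ a).subtype
  have e1 : finrank ℂ W' = finrank ℂ W :=
    (Submodule.comapSubtypeEquivOfLe hW).finrank_eq
  have e2 := Submodule.finrank_quotient_add_finrank W'
  have e3 : finrank ℂ (homogeneousSubmodule (Fin 3) ℂ a ⧸ W') = finrank ℂ (Fin c → ℂ) := by
    rw [finrank_fin_fun]; omega
  let e := LinearEquiv.ofFinrankEq _ _ e3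
  obtain ⟨L, hL⟩ := LinearMap.exists_extend (e.toLinearMap ∘ₗ W'.mkQ)
  have hL' : ∀ p (hp : p ∈ homogeneousSubmodule (Fin 3) ℂ a), L p = e (W'.mkQ ⟨p, hp⟩) :=
    fun p hp => LinearMap.congr_fun hL ⟨p, hp⟩
  refine ⟨L, ?_, ?_⟩
  · intro p hp h
    rw [hL' p hp, LinearEquiv.map_eq_zero_iff] at h
    have := (Submodule.Quotient.mk_eq_zero _).1 h
    exact this
  · intro u
    obtain ⟨⟨p, hp⟩, h⟩ := W'.mkQ_surjective (e.symm u)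
    exact ⟨p, hp, by rw [hL' p hp, h, e.apply_symm_apply]⟩

theorem green_restriction_corollary (a c : ℕ) (hca : c < a)
    (W : Submodule ℂ (MvPolynomial (Fin 3) ℂ))
    (hW : W ≤ homogeneousSubmodule (Fin 3) ℂ a)
    (hcodim : finrank ℂ W + c = finrank ℂ (homogeneousSubmodule (Fin 3) ℂ a)) :
    ∃ g : MvPolynomial (Fin 3) ℂ, g ≠ 0 ∧
      ∀ v : Fin 3 → ℂ, eval v g ≠ 0 →
        ∀ p ∈ homogeneousSubmodule (Fin 3) ℂ a,
          ∃ w ∈ W, p - w ∈ Ideal.span {(∑ i, C (v i) * X i : MvPolynomial (Fin 3) ℂ)} := by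
  classical
  obtain ⟨L, hLW, hLs⟩ := exists_functionals a c W hW hcodim
  have hlin : ∀ v : Fin 3 → ℂ, (∑ i, C (v i) * X i : MvPolynomial (Fin 3) ℂ).IsHomogeneous 1 :=
    fun v => IsHomogeneous.sum _ _ _ fun i _ => by
      simpa using (isHomogeneous_C (Fin 3) (v i)).mul (isHomogeneous_X ℂ i)
  have hLh : ∀ (v : Fin 3 → ℂ) (m : MvPolynomial (Fin 3) ℂ) (j : Fin c),
      L ((∑ i, C (v i) * X i) * m) j = ∑ i, v i * L (X i * m) j := by
    intro v m j
    rw [Finset.sum_mul, map_sum, Finset.sum_apply]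
    refine Finset.sum_congr rfl fun i _ => ?_
    rw [mul_assoc, ← smul_eq_C_mul, map_smul, Pi.smul_apply, smul_eq_mul]
  let I := {k // k ∈ Finset.piAntidiag (Finset.univ : Finset (Fin 3)) (a - 1)}
  let _ : Fintype I := Finset.fintypeCoeSort _
  let mon : I → MvPolynomial (Fin 3) ℂ := fun k => monomial (Finsupp.equivFunOnFinite.symm k.1) 1
  have hmon : ∀ k, (mon k).IsHomogeneous (a - 1) := by
    intro k
    apply isHomogeneous_monomial
    have := (Finset.mem_piAntidiag.1 k.2).1
    rw [Finsupp.degree_eq_sum]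
    simpa using this
  let M : Matrix I (Fin c) (MvPolynomial (Fin 3) ℂ) :=
    Matrix.of fun k j => ∑ i, X i * C (L (X i * mon k) j)
  have hMv : ∀ v k j, eval v (M k j) = L ((∑ i, C (v i) * X i) * mon k) j := by
    intro v k j
    rw [hLh]
    simp [M]
  rcases dichotomy M with ⟨l, hl0, hl⟩ | ⟨g, hg, N, hN⟩
  · exfalso
    have T0 : ∀ m ∈ homogeneousSubmodule (Fin 3) ℂ (a - 1),
        ∑ j, ∑ i, X i * C (L (X i * m) j) * l j = 0 := by
      intro m hm
      have hmsum : m = ∑ k : I, coeff (Finsupp.equivFunOnFinite.symm k.1) m • mon k := by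
        ext d
        simp only [mon, coeff_sum, coeff_smul, coeff_monomial, smul_eq_mul, mul_ite, mul_one,
          mul_zero]
        by_cases hd : d.degree = a - 1
        · have hd' : (d : Fin 3 → ℕ) ∈ Finset.piAntidiag (Finset.univ : Finset (Fin 3)) (a - 1) := by
            simp only [Finset.mem_piAntidiag]
            refine ⟨?_, by simp⟩
            rw [← hd, Finsupp.degree_eq_sum]
          rw [Finset.sum_eq_single (⟨d, hd'⟩ : I)]
          · simp
          · intro b _ hb
            rw [if_neg]
            rintro rfl
            exact hb (by simp)
          · simp
        · have hm0 : coeff d m = 0 := IsHomogeneous.coeff_eq_zero hm hd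
          rw [hm0]
          symm
          refine Finset.sum_eq_zero fun k _ => ?_
          split_ifs with h
          · rw [h, hm0]
          · rfl
      have hk : ∀ k, ∑ j, ∑ i, X i * C (L (X i * mon k) j) * l j = 0 := by
        intro k
        have := congrFun hl k
        simpa [Matrix.mulVec, dotProduct, M, Finset.sum_mul] using this
      let F : MvPolynomial (Fin 3) ℂ →ₗ[ℂ] MvPolynomial (Fin 3) ℂ :=
        { toFun := fun m => ∑ j, ∑ i, X i * C (L (X i * m) j) * l j
          map_add' := by
            intro p q
            simp only [mul_add, map_add, Pi.add_apply, add_mul, Finset.sum_add_distrib]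
          map_smul' := by
            intro r p
            simp only [mul_smul_comm, map_smul, Pi.smul_apply]
            simp only [smul_eq_C_mul, Finset.mul_sum, RingHom.id_apply, smul_eq_mul, map_mul]
            refine Finset.sum_congr rfl fun j _ => Finset.sum_congr rfl fun i _ => ?_
            ring }
      change F m = 0
      rw [hmsum, map_sum]
      refine Finset.sum_eq_zero fun k _ => ?_
      rw [map_smul]
      rw [show F (mon k) = 0 from hk k, smul_zero]
    obtain ⟨j0, hj0⟩ := Function.ne_iff.1 hl0
    obtain ⟨v, hv⟩ : ∃ v, eval v (l j0) ≠ 0 := by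
      by_contra! hcon
      exact hj0 (MvPolynomial.funext (by simpa using hcon))
    obtain ⟨y, hy⟩ : ∃ y : Fin 3 → ℂ,
        (fun j => eval v (l j)) ⬝ᵥ L ((∑ i, C (y i) * X i) ^ a) ≠ 0 := by
      by_contra! hcon
      let φ : MvPolynomial (Fin 3) ℂ →ₗ[ℂ] ℂ :=
        (dotProductBilin ℂ ℂ (fun j => eval v (l j))) ∘ₗ L
      obtain ⟨p, hp, hpL⟩ := hLs (Pi.single j0 1)
      have := powers_span a φ hcon p hp
      apply hv
      have h2 : (fun j => eval v (l j)) ⬝ᵥ L p = 0 := this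
      rw [hpL] at h2
      simpa using h2
    let D : Derivation ℂ (MvPolynomial (Fin 3) ℂ) (MvPolynomial (Fin 3) ℂ) :=
      mkDerivation ℂ (fun i => C (y i))
    have hDX : ∀ i, D (X i) = C (y i) := fun i => mkDerivation_X _ _ _
    have hDC : ∀ r, D (C r) = 0 := fun r => derivation_C _ _
    have Tk : ∀ k : ℕ, ∀ m ∈ homogeneousSubmodule (Fin 3) ℂ (a - 1),
        ∑ j, ∑ i, (X i * C (L (X i * m) j) * D^[k] (l j) +
          (k : MvPolynomial (Fin 3) ℂ) * (C (y i) * C (L (X i * m) j) * D^[k - 1] (l j))) = 0 := by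
      intro k m hm
      induction k with
      | zero => simpa using T0 m hm
      | succ k ih =>
        have := congrArg D ih
        rw [map_zero, map_sum] at this
        rw [← this]
        refine Finset.sum_congr rfl fun j _ => ?_
        rw [map_sum]
        refine Finset.sum_congr rfl fun i _ => ?_
        simp only [map_add, Derivation.leibniz, hDX, hDC, Function.iterate_succ_apply',
          Derivation.map_natCast, smul_eq_mul]
        rcases k with _ | k
        · simp
          ring
        · simp only [Nat.add_sub_cancel, Function.iterate_succ_apply']
          push_cast
          ring
    refine triangular a c hca (fun k j => eval v (D^[k] (l j))) L (∑ i, C (v i) * X i)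
      (∑ i, C (y i) * X i) (hlin v) (hlin y) ?_ (by simpa using hy)
    intro k m hm
    have := congrArg (eval v) (Tk k m hm)
    simp only [map_sum, map_add, map_mul, eval_X, eval_C, map_natCast, map_zero,
      Finset.sum_add_distrib] at this
    simp only [dotProduct, hLh, Finset.mul_sum]
    rw [eq_comm, ← sub_eq_zero, ← neg_eq_zero, ← this, ← Finset.sum_sub_distrib,
      ← Finset.sum_neg_distrib, ← Finset.sum_add_distrib]
    refine Finset.sum_congr rfl fun j _ => ?_
    rw [← Finset.sum_sub_distrib, ← Finset.sum_neg_distrib, ← Finset.sum_add_distrib]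
    refine Finset.sum_congr rfl fun i _ => ?_
    ring
  · refine ⟨g, hg, fun v hv p hp => ?_⟩
    let q : MvPolynomial (Fin 3) ℂ :=
      ∑ k : I, ((eval v g)⁻¹ * ∑ j, L p j * eval v (N j k)) • mon k
    have hq : q.IsHomogeneous (a - 1) :=
      (homogeneousSubmodule (Fin 3) ℂ (a - 1)).sum_mem fun k _ =>
        Submodule.smul_mem _ _ (hmon k)
    refine ⟨p - (∑ i, C (v i) * X i) * q, hLW _ ?_ ?_, ?_⟩
    · refine Submodule.sub_mem _ hp ?_
      have := (hlin v).mul hq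
      rw [mem_homogeneousSubmodule]
      convert this using 1
      omega
    · rw [map_sub, sub_eq_zero]
      ext j
      have hNM : ∀ i, ∑ k, eval v (N i k) * eval v (M k j) = if i = j then eval v g else 0 := by
        intro i
        have := congrArg (eval v) (congrFun (congrFun hN i) j)
        rw [Matrix.mul_apply, map_sum] at this
        simp only [map_mul] at this
        rw [this]
        simp [Matrix.one_apply, apply_ite (eval v)]
      have hLq : L ((∑ i, C (v i) * X i) * q) j =
          ∑ k, ((eval v g)⁻¹ * ∑ j, L p j * eval v (N j k)) * eval v (M k j) := by
        rw [Finset.mul_sum, map_sum, Finset.sum_apply]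
        refine Finset.sum_congr rfl fun k _ => ?_
        rw [mul_smul_comm, map_smul, Pi.smul_apply, hMv, smul_eq_mul]
      rw [hLq]
      simp only [Finset.mul_sum, Finset.sum_mul]
      rw [Finset.sum_comm]
      have : ∀ i, ∑ k, (eval v g)⁻¹ * (L p i * eval v (N i k)) * eval v (M k j) =
          (eval v g)⁻¹ * L p i * if i = j then eval v g else 0 := by
        intro i
        rw [← hNM, Finset.mul_sum]
        refine Finset.sum_congr rfl fun k _ => ?_
        ring
      simp only [this]
      simp
      field_simp
    · rw [sub_sub_cancel]
      exact Ideal.mul_mem_right _ _ (Ideal.subset_span rfl)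
end
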